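/- arXiv:1801.00179 — 2 statements merged into one kernel-verified Lean document; each statement's English description precedes it below -/
import Mathlib

section
/- Let G be a graph, let A and B be sets of vertices of G, and let 𝒫 be a finite set of pairwise disjoint A–B paths. If some walk that is alternating with respect to 𝒫 ends in B ∖ V(⋃𝒫), then G contains a set 𝒫′ of pairwise disjoint A–B paths with |𝒫′| = |𝒫| + 1. Moreover, the alternating walk W can be chosen so that (1) the edge set E(𝒫′) is precisely the symmetric difference E(𝒫) △ E(W), and (2) every path P′ ∈ 𝒫′ traverses the edges of E(P′) ∩ E(W) in the same order as W does. -/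
open Topology

noncomputable section

variable {V : Type*}

open Classical in
/-- The Dirac function marking a vertex: the point of `|G|` corresponding to vertex `v`. -/
noncomputable def vertexPoint (v : V) : V → ℝ := fun u => if u = v then 1 else 0

open Classical in
/-- The point of `|G|` lying on the edge `vw` at parameter `t` (measured from `v` towards `w`). -/
noncomputable def edgePoint (v w : V) (t : ℝ) : V → ℝ :=
  fun u => (if u = v then 1 - t else 0) + (if u = w then t else 0)

/-- The geometric realization `|G|` of a simple graph `G`, realized as the set of
formal convex combinations of adjacent pairs of vertices; each closed edge carries
its usual topology as a copy of `[0,1]`. -/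
def GraphRealization (G : SimpleGraph V) : Set (V → ℝ) :=
  {x | (∃ v, x = vertexPoint v) ∨
    ∃ v w t, G.Adj v w ∧ t ∈ Set.Icc (0 : ℝ) 1 ∧ x = edgePoint v w t}

/-- A subset of a topological space is an arc if it is homeomorphic to `[0,1]`. -/
def IsArc {X : Type*} [TopologicalSpace X] (A : Set X) : Prop :=
  Nonempty (↥A ≃ₜ ↥unitInterval)

/-- A space is `n`-arc connected if any at most `n` points lie on a common arc. -/
def NArcConn (X : Type*) [TopologicalSpace X] (n : ℕ) : Prop :=
  ∀ S : Finset X, S.card ≤ n → ∃ A : Set X, IsArc A ∧ ↑S ⊆ A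

/-- The unit circle in the plane. -/
def unitCircleSet : Set (ℝ × ℝ) := {p | p.1 ^ 2 + p.2 ^ 2 = 1}

/-- A subset of a topological space is a simple closed curve if homeomorphic to the circle. -/
def IsSimpleClosedCurve {X : Type*} [TopologicalSpace X] (C : Set X) : Prop :=
  Nonempty (↥C ≃ₜ ↥unitCircleSet)

/-- A space is `n`-circle connected if any at most `n` points lie on a common
simple closed curve. -/
def NCircleConn (X : Type*) [TopologicalSpace X] (n : ℕ) : Prop :=
  ∀ S : Finset X, S.card ≤ n → ∃ C : Set X, IsSimpleClosedCurve C ∧ ↑S ⊆ C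

/-- A space is `n`-strongly arc connected if any list of at most `n` points is contained
in an arc, the points appearing along the arc in the listed order. -/
def NStrongArcConn (X : Type*) [TopologicalSpace X] (n : ℕ) : Prop :=
  ∀ l : List X, l.length ≤ n →
    ∃ f : ↥unitInterval → X, Topology.IsEmbedding f ∧
      ∃ t : Fin l.length → ↥unitInterval, Monotone t ∧ ∀ i, f (t i) = l.get i

/-- A graph is `k`-connected if removing fewer than `k` vertices leaves it connected. -/
def KConnected (G : SimpleGraph V) (k : ℕ) : Prop :=
  ∀ S : Set V, S.encard < (k : ℕ∞) → (G.induce (Sᶜ : Set V)).Connected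

/-- A graph is cyclically connected if any two vertices lie on a common cycle. -/
def CyclicallyConnected (G : SimpleGraph V) : Prop :=
  ∀ v w : V, ∃ (u : V) (c : G.Walk u u), c.IsCycle ∧ v ∈ c.support ∧ w ∈ c.support

/-- The circle of radius `r` centered at `c` in the plane. -/
def circleAt (c : ℝ × ℝ) (r : ℝ) : Set (ℝ × ℝ) :=
  {p | (p.1 - c.1) ^ 2 + (p.2 - c.2) ^ 2 = r ^ 2}

/-- The horizontal segment at height `y` from abscissa `a` to `b`. -/
def hSeg (y a b : ℝ) : Set (ℝ × ℝ) := {p | p.2 = y ∧ a ≤ p.1 ∧ p.1 ≤ b}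

/-- The θ-curve: unit circle together with horizontal diameter. -/
def thetaSet : Set (ℝ × ℝ) := circleAt (0, 0) 1 ∪ hSeg 0 (-1) 1

/-- Figure-eight: two unit circles meeting at the origin. -/
def figureEightSet : Set (ℝ × ℝ) := circleAt (-1, 0) 1 ∪ circleAt (1, 0) 1

/-- Lollipop: unit circle with the segment from `(1,0)` to `(2,0)` attached. -/
def lollipopSet : Set (ℝ × ℝ) := circleAt (0, 0) 1 ∪ hSeg 0 1 2

/-- Lollipop with its free endpoint removed. -/
def openLollipopSet : Set (ℝ × ℝ) := lollipopSet \ {(2, 0)}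

/-- Dumbbell: two disjoint unit circles joined by a segment. -/
def dumbbellSet : Set (ℝ × ℝ) := circleAt (-2, 0) 1 ∪ circleAt (2, 0) 1 ∪ hSeg 0 (-1) 1

/-- Happy-face curve: two circles meeting at a point, joined by a further arc. -/
def happyFaceSet : Set (ℝ × ℝ) :=
  circleAt (-1, 0) 1 ∪ circleAt (1, 0) 1 ∪ {p | p.1 ^ 2 + p.2 ^ 2 = 4 ∧ p.2 ≤ 0}

/-- Baguette curve: two disjoint circles joined by two disjoint arcs. -/
def baguetteSet : Set (ℝ × ℝ) :=
  circleAt (-3, 0) 1 ∪ circleAt (3, 0) 1 ∪ hSeg 0 (-2) 2 ∪ hSeg 1 (-3) 3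

/-- A graph is a basic 4-ac graph iff its realization is homeomorphic to a circle,
a θ-curve, a happy-face curve or a baguette curve (this captures precisely the
subdivisions of those four graphs). -/
def IsBasicFourAC {W : Type*} (H : SimpleGraph W) : Prop :=
  Nonempty (↥(GraphRealization H) ≃ₜ ↥unitCircleSet) ∨
  Nonempty (↥(GraphRealization H) ≃ₜ ↥thetaSet) ∨
  Nonempty (↥(GraphRealization H) ≃ₜ ↥happyFaceSet) ∨
  Nonempty (↥(GraphRealization H) ≃ₜ ↥baguetteSet)

/-- A chain-graph decomposition of the connected graph `G`: links indexed by an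
interval `J` of `ℤ`, non-consecutive links are disjoint, consecutive links share
exactly one vertex. -/
structure IsChainGraph (G : SimpleGraph V) (J : Set ℤ) (L : ℤ → G.Subgraph) : Prop where
  connected : G.Connected
  ordConnected : J.OrdConnected
  nonempty : J.Nonempty
  cover : (⨆ i ∈ J, L i) = (⊤ : G.Subgraph)
  sep : ∀ i ∈ J, ∀ j ∈ J, i + 1 < j → (L i).verts ∩ (L j).verts = ∅
  link : ∀ i ∈ J, i + 1 ∈ J → ∃ v, (L i).verts ∩ (L (i + 1)).verts = {v}

/-- A cut-vertex: a vertex whose removal disconnects the graph. -/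
def IsCutVertex (G : SimpleGraph V) (v : V) : Prop :=
  ¬ (G.induce ({v}ᶜ : Set V)).Connected

/-- A block: a maximal 2-connected subgraph. -/
def IsBlock (G : SimpleGraph V) (H : G.Subgraph) : Prop :=
  KConnected H.coe 2 ∧ ∀ H' : G.Subgraph, H ≤ H' → KConnected H'.coe 2 → H' = H

/-- The block graph of `G`: the bipartite graph on cut-vertices and blocks, a cut-vertex
being adjacent to the blocks containing it. -/
def BlockGraph (G : SimpleGraph V) :
    SimpleGraph ({v : V // IsCutVertex G v} ⊕ {H : G.Subgraph // IsBlock G H}) :=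
  SimpleGraph.fromRel fun a b =>
    ∃ (c : {v : V // IsCutVertex G v}) (B : {H : G.Subgraph // IsBlock G H}),
      a = Sum.inl c ∧ b = Sum.inr B ∧ (c : V) ∈ (B : G.Subgraph).verts

/-- An `A`–`B` path: a path starting in `A`, ending in `B` and meeting `A ∪ B` only
in these two endvertices. -/
structure ABPath (G : SimpleGraph V) (A B : Set V) where
  first : V
  last : V
  walk : G.Walk first last
  isPath : walk.IsPath
  firstA : first ∈ A
  lastB : last ∈ B
  meetA : ∀ v ∈ walk.support, v ∈ A → v = first
  meetB : ∀ v ∈ walk.support, v ∈ B → v = last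

/-- A family of pairwise vertex-disjoint paths. -/
def PathFamilyDisjoint {G : SimpleGraph V} {A B : Set V} {k : ℕ}
    (P : Fin k → ABPath G A B) : Prop :=
  ∀ i j, i ≠ j → ∀ v, v ∈ (P i).walk.support → v ∉ (P j).walk.support

/-- The set of vertices used by a family of paths. -/
def familySupport {G : SimpleGraph V} {A B : Set V} {k : ℕ}
    (P : Fin k → ABPath G A B) : Set V :=
  {v | ∃ i, v ∈ (P i).walk.support}

/-- The set of edges used by a family of paths. -/
def familyEdges {G : SimpleGraph V} {A B : Set V} {k : ℕ}
    (P : Fin k → ABPath G A B) : Set (Sym2 V) :=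
  {e | ∃ i, e ∈ (P i).walk.edges}

/-- A walk `W` (with no repeated edges) is alternating with respect to the disjoint
path family `P`: it starts in `A` off the paths; repeated vertices lie on paths of the
family; upon hitting a path by a new edge it follows that path backwards for at least
one edge; and it traverses edges of paths of the family only backwards. -/
structure IsAlternatingWalk {G : SimpleGraph V} {A B : Set V} {k : ℕ}
    (P : Fin k → ABPath G A B) {x y : V} (W : G.Walk x y) : Prop where
  trail : W.IsTrail
  startA : x ∈ A
  startOff : x ∉ familySupport P
  repeats : ∀ v, List.Duplicate v W.support → v ∈ familySupport P
  follows : ∀ (i : ℕ) (hi : i < W.darts.length) (j : Fin k),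
      (W.darts.get ⟨i, hi⟩).snd ∈ (P j).walk.support →
      (W.darts.get ⟨i, hi⟩).edge ∉ (P j).walk.edges →
      ∃ h : i + 1 < W.darts.length, (W.darts.get ⟨i + 1, h⟩).symm ∈ (P j).walk.darts
  backward : ∀ d ∈ W.darts, ∀ j : Fin k,
      d.edge ∈ (P j).walk.edges → d.symm ∈ (P j).walk.darts

end

open Relation

namespace SimpleGraph.Walk

variable {V : Type*} {G : SimpleGraph V} {x y : V}

/-- The walk `w` traverses the edge `ab` from `a` to `b`. -/
def Step (w : G.Walk x y) (a b : V) : Prop :=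
  ∃ i < w.length, w.getVert i = a ∧ w.getVert (i + 1) = b

theorem mem_darts_iff_step {w : G.Walk x y} {d : G.Dart} :
    d ∈ w.darts ↔ w.Step d.fst d.snd := by
  rw [List.mem_iff_getElem]
  constructor
  · rintro ⟨i, hi, rfl⟩
    exact ⟨i, by simpa using hi, by simp [fst_darts_getElem, getVert_eq_support_getElem _
      (show i ≤ w.length by rw [length_darts] at hi; omega)],
      by simp [snd_darts_getElem, getVert_eq_support_getElem _
      (show i + 1 ≤ w.length by rw [length_darts] at hi; omega)]⟩
  · rintro ⟨i, hi, h₁, h₂⟩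
    refine ⟨i, by simpa using hi, ?_⟩
    ext
    · rw [darts_getElem_eq_getVert, ← h₁]
    · rw [darts_getElem_eq_getVert, ← h₂]

theorem Step.adj {w : G.Walk x y} {a b : V} (h : w.Step a b) : G.Adj a b := by
  obtain ⟨i, hi, rfl, rfl⟩ := h
  exact w.adj_getVert_succ hi

theorem mem_edges_iff_step {w : G.Walk x y} {a b : V} :
    s(a, b) ∈ w.edges ↔ w.Step a b ∨ w.Step b a := by
  rw [edges_eq_map_darts, List.mem_map]
  constructor
  · rintro ⟨d, hd, h⟩
    rw [mem_darts_iff_step] at hd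
    obtain h | h := (dart_edge_eq_mk'_iff' (d := d)).1 h
    · exact .inl (h.1 ▸ h.2 ▸ hd)
    · exact .inr (h.1 ▸ h.2 ▸ hd)
  · rintro (h | h)
    · exact ⟨⟨(a, b), h.adj⟩, mem_darts_iff_step.2 h, rfl⟩
    · exact ⟨⟨(b, a), h.adj⟩, mem_darts_iff_step.2 h, Sym2.eq_swap⟩

theorem IsTrail.index_unique {w : G.Walk x y} (hw : w.IsTrail) {i j : ℕ} (hi : i < w.length)
    (hj : j < w.length)
    (h : s(w.getVert i, w.getVert (i + 1)) = s(w.getVert j, w.getVert (j + 1))) : i = j := by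
  have hi' : i < w.edges.length := by simpa using hi
  have hj' : j < w.edges.length := by simpa using hj
  refine (hw.edges_nodup.getElem_inj_iff (hi := hi') (hj := hj')).1 ?_
  simpa [edges_eq_map_darts, darts_getElem_eq_getVert] using h

theorem IsTrail.not_step_symm {w : G.Walk x y} (hw : w.IsTrail) {a b : V} (h : w.Step a b) :
    ¬ w.Step b a := by
  rintro ⟨j, hj, rfl, rfl⟩
  obtain ⟨i, hi, h₁, h₂⟩ := h
  have hij : i = j := hw.index_unique hi hj (by rw [h₁, h₂, Sym2.eq_swap])
  subst hij
  exact (w.adj_getVert_succ hi).ne h₁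

/-- A walk all of whose steps obey `R`. -/
def Obeys (R : V → V → Prop) (w : G.Walk x y) : Prop :=
  ∀ d ∈ w.darts, R d.fst d.snd

theorem exists_obeys_of_reflTransGen {R : V → V → Prop} (hR : ∀ u v, R u v → G.Adj u v)
    {a b : V} (h : ReflTransGen R a b) : ∃ w : G.Walk a b, w.Obeys R := by
  induction h using ReflTransGen.head_induction_on with
  | refl => exact ⟨nil, by simp [Obeys]⟩
  | head h _ ih =>
    obtain ⟨w, hw⟩ := ih
    exact ⟨cons (hR _ _ h) w, by simpa [Obeys] using ⟨h, hw⟩⟩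

theorem Obeys.reflTransGen {R : V → V → Prop} {w : G.Walk x y} (hw : w.Obeys R) {v : V}
    (hv : v ∈ w.support) : ReflTransGen R x v := by
  induction w with
  | nil => simp at hv; subst hv; rfl
  | cons h p ih =>
    simp only [Obeys, darts_cons, List.forall_mem_cons] at hw
    rw [support_cons, List.mem_cons] at hv
    obtain rfl | hv := hv
    · rfl
    · exact .head hw.1 (ih hw.2 hv)

theorem Obeys.isPath {R : V → V → Prop} (hR : ∀ v, ¬ TransGen R v v) {w : G.Walk x y}
    (hw : w.Obeys R) : w.IsPath := by
  induction w with
  | nil => simp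
  | cons h p ih =>
    simp only [Obeys, darts_cons, List.forall_mem_cons] at hw
    rw [cons_isPath_iff]
    exact ⟨ih hw.2, fun hv => hR _ (.head' hw.1 (Obeys.reflTransGen hw.2 hv))⟩

theorem exists_dart_snd {w : G.Walk x y} {v : V} (hv : v ∈ w.support) :
    v = x ∨ ∃ d ∈ w.darts, d.snd = v := by
  rw [← cons_map_snd_darts] at hv
  simpa using hv

theorem exists_dart_fst {w : G.Walk x y} {v : V} (hv : v ∈ w.support) :
    v = y ∨ ∃ d ∈ w.darts, d.fst = v := by
  rw [← map_fst_darts_append] at hv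
  simpa [or_comm] using hv

end SimpleGraph.Walk

/-- `E` is the successor relation of a family of disjoint directed paths with vertex set `F`,
initial vertices `S` and terminal vertices `T`. -/
structure IsLinearSystem {V : Type*} (E : V → V → Prop) (F S T : Set V) : Prop where
  rightUnique : ∀ {u v v'}, E u v → E u v' → v = v'
  leftUnique : ∀ {u u' v}, E u v → E u' v → u = u'
  acyclic : ∀ v, ¬ TransGen E v v
  mem_left : ∀ {u v}, E u v → u ∈ F
  mem_right : ∀ {u v}, E u v → v ∈ F
  pred : ∀ {v}, v ∈ F → v ∈ S ∨ ∃ u, E u v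
  succ : ∀ {v}, v ∈ F → v ∈ T ∨ ∃ w, E v w
  not_to_source : ∀ {u v}, v ∈ S → ¬ E u v
  not_from_target : ∀ {v w}, v ∈ T → ¬ E v w

theorem ReflTransGen.unique_source {V : Type*} {R : V → V → Prop}
    (hR : ∀ {u u' v}, R u v → R u' v → u = u') {s s' v : V} (hs : ∀ u, ¬ R u s)
    (hs' : ∀ u, ¬ R u s') (h : ReflTransGen R s v) (h' : ReflTransGen R s' v) : s = s' := by
  induction h with
  | refl =>
    obtain rfl | ⟨u, _, hu⟩ := h'.cases_tail
    · rfl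
    · exact absurd hu (hs u)
  | tail _ h ih =>
    obtain rfl | ⟨u, hu', hu⟩ := h'.cases_tail
    · exact absurd h (hs' _)
    · exact ih (hR h hu ▸ hu')

theorem ReflTransGen.mem_support {V : Type*} {G : SimpleGraph V} {R : V → V → Prop}
    (hR : ∀ {u v v'}, R u v → R u v' → v = v') {s t v : V} {p : G.Walk s t} (hp : p.Obeys R)
    (ht : ∀ w, ¬ R t w) (h : ReflTransGen R s v) : v ∈ p.support := by
  induction h with
  | refl => simp
  | tail _ h ih =>
    obtain rfl | ⟨d, hd, rfl⟩ := SimpleGraph.Walk.exists_dart_fst ih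
    · exact absurd h (ht _)
    · rw [hR h (hp d hd)]
      exact p.dart_snd_mem_support_of_mem_darts hd

section Finite

variable {V : Type*} {R : V → V → Prop} {X : Set V}

theorem exists_reflTransGen_source {S : Set V} (hX : X.Finite) (hacyc : ∀ v, ¬ TransGen R v v)
    (hmem : ∀ {u v}, R u v → u ∈ X) (hin : ∀ {v w}, R v w → v ∈ S ∨ ∃ u, R u v) {v w : V}
    (h : R v w) : ∃ s ∈ S, ReflTransGen R s v := by
  have : IsStrictOrder V (TransGen R) := { irrefl := hacyc, trans := fun _ _ _ => .trans }
  refine (hX.wellFoundedOn (r := TransGen R)).induction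
    (P := fun v => ∀ w, R v w → ∃ s ∈ S, ReflTransGen R s v) (hmem h) ?_ w h
  intro v _ ih w h
  obtain hv | ⟨u, hu⟩ := hin h
  · exact ⟨v, hv, .refl⟩
  · obtain ⟨s, hs, hsu⟩ := ih u (hmem hu) (.single hu) v hu
    exact ⟨s, hs, hsu.tail hu⟩

theorem exists_reflTransGen_target {T : Set V} (hX : X.Finite) (hacyc : ∀ v, ¬ TransGen R v v)
    (hmem : ∀ {u v}, R u v → v ∈ X) (hout : ∀ {u v}, R u v → v ∈ T ∨ ∃ w, R v w) {s : V}
    (hs : s ∈ T ∨ ∃ w, R s w) : ∃ t ∈ T, ReflTransGen R s t := by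
  obtain hs | ⟨w, h⟩ := hs
  · exact ⟨s, hs, .refl⟩
  obtain ⟨t, ht, h'⟩ := exists_reflTransGen_source (R := Function.swap R) (S := T) (w := s) hX
    (fun v hv => hacyc v (transGen_swap.1 hv)) hmem hout h
  exact ⟨t, ht, .head h (reflTransGen_swap.1 h')⟩

end Finite

/-- `W` is an alternating walk from `A` to `B` with respect to the disjoint directed paths with
successor relation `E` and vertex set `F`, with both ends outside `F`. -/
structure Alternates {V : Type*} {G : SimpleGraph V} (E : V → V → Prop) (F A B : Set V) {x y : V}
    (W : G.Walk x y) : Prop where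
  trail : W.IsTrail
  startA : x ∈ A
  startOff : x ∉ F
  endB : y ∈ B
  endOff : y ∉ F
  repeats : ∀ v, List.Duplicate v W.support → v ∈ F
  follows : W.darts.IsChain fun d d' => d.snd ∈ F → ¬ E d.snd d.fst → E d'.snd d'.fst
  backward : ∀ d ∈ W.darts, ¬ E d.fst d.snd

open Classical in
/-- The number of edges of `W` that are not reversed edges of `E`. -/
noncomputable def newCount {V : Type*} {G : SimpleGraph V} (E : V → V → Prop)
    {x y : V} (W : G.Walk x y) : ℕ :=
  W.darts.countP fun d => ¬ E d.snd d.fst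

/-- The steps of `E` whose reversal is not taken by `W`. -/
def KeptStep {V : Type*} {G : SimpleGraph V} (E : V → V → Prop) {x y : V} (W : G.Walk x y)
    (u v : V) : Prop :=
  E u v ∧ ¬ W.Step v u

/-- The steps of `W` that are not reversed steps of `E`. -/
def NewStep {V : Type*} {G : SimpleGraph V} (E : V → V → Prop) {x y : V} (W : G.Walk x y)
    (u v : V) : Prop :=
  W.Step u v ∧ ¬ E v u

/-- The steps of the symmetric difference of `E` and `W`. -/
def DiffStep {V : Type*} {G : SimpleGraph V} (E : V → V → Prop) {x y : V} (W : G.Walk x y)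
    (u v : V) : Prop :=
  KeptStep E W u v ∨ NewStep E W u v

/-- From the new step at index `i`, the walk `W` enters a directed path on which `v` can be reached
along kept steps. -/
def Tracks {V : Type*} {G : SimpleGraph V} (E : V → V → Prop) {x y : V} (W : G.Walk x y)
    (i : ℕ) (v : V) : Prop :=
  i < W.length ∧ ¬ E (W.getVert (i + 1)) (W.getVert i) ∧
    ReflTransGen (KeptStep E W) (W.getVert (i + 1)) v

/-- `W` has the least number of new steps among all alternating walks. -/
def IsMinimalAlternating {V : Type*} {G : SimpleGraph V} (E : V → V → Prop) (F A B : Set V)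
    {x y : V} (W : G.Walk x y) : Prop :=
  ∀ ⦃x' y' : V⦄ (W' : G.Walk x' y'), Alternates E F A B W' → newCount E W ≤ newCount E W'

namespace Alternates

variable {V : Type*} {G : SimpleGraph V} {E : V → V → Prop} {F S T A B : Set V} {x y : V}
  {W : G.Walk x y}

theorem not_step (h : Alternates E F A B W) {u v : V} (huv : E u v) : ¬ W.Step u v := fun hW =>
  h.backward ⟨(u, v), hW.adj⟩ (SimpleGraph.Walk.mem_darts_iff_step.2 hW) huv

theorem index_unique_of_notMem (h : Alternates E F A B W) {i j : ℕ} (hi : i ≤ W.length)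
    (hj : j ≤ W.length) (hF : W.getVert i ∉ F) (hij : W.getVert i = W.getVert j) : i = j := by
  wlog hlt : i < j generalizing i j
  · obtain hlt' | rfl | hlt' := lt_trichotomy i j
    · exact absurd hlt' hlt
    · rfl
    · exact (this hj hi (hij ▸ hF) hij.symm hlt').symm
  refine absurd (h.repeats _ (List.duplicate_iff_exists_distinct_get.2
    ⟨⟨i, by simp; omega⟩, ⟨j, by simp; omega⟩, hlt, ?_, ?_⟩)) hF
  · simp [SimpleGraph.Walk.getVert_eq_support_getElem _ hi]
  · simp [hij, SimpleGraph.Walk.getVert_eq_support_getElem _ hj]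

theorem follows_index (h : Alternates E F A B W) {i : ℕ} (hi : i < W.length)
    (hF : W.getVert (i + 1) ∈ F) (hE : ¬ E (W.getVert (i + 1)) (W.getVert i)) :
    i + 1 < W.length ∧ E (W.getVert (i + 2)) (W.getVert (i + 1)) := by
  have hlt : i + 1 < W.length := by
    refine lt_of_le_of_ne hi fun heq => h.endOff ?_
    rwa [heq, W.getVert_length] at hF
  have := List.isChain_iff_getElem.1 h.follows i (by simpa using hlt)
  simp only [SimpleGraph.Walk.darts_getElem_eq_getVert] at this
  exact ⟨hlt, this hF hE⟩

theorem exists_of_new (h : Alternates E F A B W) {i : ℕ} (hi : i < W.length)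
    (hF : W.getVert i ∈ F) (hE : ¬ E (W.getVert (i + 1)) (W.getVert i)) :
    ∃ k, i = k + 1 ∧ E (W.getVert (k + 1)) (W.getVert k) := by
  cases i with
  | zero => exact absurd (by simpa using hF) h.startOff
  | succ k =>
    refine ⟨k, rfl, by_contra fun hk => hE ?_⟩
    exact (h.follows_index (by omega) hF hk).2

theorem diffStep_adj (hadj : ∀ {u v}, E u v → G.Adj u v) {u v : V} (huv : DiffStep E W u v) :
    G.Adj u v :=
  huv.elim (fun h => hadj h.1) (fun h => h.1.adj)

theorem diffStep_rightUnique (h : Alternates E F A B W) (hE : IsLinearSystem E F S T)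
    {u v v' : V} (hv : DiffStep E W u v) (hv' : DiffStep E W u v') : v = v' := by
  have mixed : ∀ {v v'}, KeptStep E W u v → ¬ NewStep E W u v' := by
    rintro v v' ⟨h₁, h₂⟩ ⟨⟨i, hi, rfl, rfl⟩, h₃⟩
    obtain ⟨k, rfl, hk⟩ := h.exists_of_new hi (hE.mem_left h₁) h₃
    exact h₂ ⟨k, by omega, hE.rightUnique hk h₁, rfl⟩
  obtain hv | hv := hv <;> obtain hv' | hv' := hv'
  · exact hE.rightUnique hv.1 hv'.1
  · exact absurd hv' (mixed hv)
  · exact absurd hv (mixed hv')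
  · obtain ⟨⟨i, hi, rfl, rfl⟩, h₁⟩ := hv
    obtain ⟨⟨j, hj, hij, rfl⟩, h₂⟩ := hv'
    suffices i = j by rw [this]
    by_cases hF : W.getVert i ∈ F
    · obtain ⟨k, rfl, hk⟩ := h.exists_of_new hi hF h₁
      obtain ⟨l, rfl, hl⟩ := h.exists_of_new hj (hij ▸ hF) (hij ▸ h₂)
      have := hE.rightUnique hk (hij ▸ hl)
      rw [h.trail.index_unique (i := k) (j := l) (by omega) (by omega) (by rw [this, hij])]
    · exact h.index_unique_of_notMem hi.le hj.le hF hij.symm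

theorem diffStep_leftUnique (h : Alternates E F A B W) (hE : IsLinearSystem E F S T)
    {u u' v : V} (hu : DiffStep E W u v) (hu' : DiffStep E W u' v) : u = u' := by
  have mixed : ∀ {u u'}, KeptStep E W u v → ¬ NewStep E W u' v := by
    rintro u u' ⟨h₁, h₂⟩ ⟨⟨i, hi, rfl, rfl⟩, h₃⟩
    obtain ⟨hi', hi''⟩ := h.follows_index hi (hE.mem_right h₁) h₃
    exact h₂ ⟨i + 1, hi', rfl, hE.leftUnique hi'' h₁⟩
  obtain hu | hu := hu <;> obtain hu' | hu' := hu'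
  · exact hE.leftUnique hu.1 hu'.1
  · exact absurd hu' (mixed hu)
  · exact absurd hu (mixed hu')
  · obtain ⟨⟨i, hi, rfl, rfl⟩, h₁⟩ := hu
    obtain ⟨⟨j, hj, rfl, hij⟩, h₂⟩ := hu'
    suffices i = j by rw [this]
    by_cases hF : W.getVert (i + 1) ∈ F
    · obtain ⟨hi', hi''⟩ := h.follows_index hi hF h₁
      obtain ⟨hj', hj''⟩ := h.follows_index hj (hij ▸ hF) (hij ▸ h₂)
      have := hE.leftUnique hi'' (hij ▸ hj'')
      have := h.trail.index_unique hi' hj' (by rw [this, hij])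
      omega
    · have := h.index_unique_of_notMem hi hj hF hij.symm
      omega

theorem not_diffStep_source (h : Alternates E F A B W) (hE : IsLinearSystem E F S T)
    (hSF : S ⊆ F) {u v : V} (hv : v = x ∨ v ∈ S) : ¬ DiffStep E W u v := by
  rintro (⟨h₁, -⟩ | ⟨⟨i, hi, rfl, rfl⟩, h₁⟩) <;> obtain hv | hv := hv
  · exact h.startOff (hv ▸ hE.mem_right h₁)
  · exact hE.not_to_source hv h₁
  · have := h.index_unique_of_notMem hi (Nat.zero_le _) (hv.symm ▸ h.startOff) (by simpa using hv)
    omega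
  · exact hE.not_to_source hv (h.follows_index hi (hSF hv) h₁).2

theorem not_diffStep_target (h : Alternates E F A B W) (hE : IsLinearSystem E F S T)
    (hTF : T ⊆ F) {v w : V} (hv : v = y ∨ v ∈ T) : ¬ DiffStep E W v w := by
  rintro (⟨h₁, -⟩ | ⟨⟨i, hi, rfl, rfl⟩, h₁⟩) <;> obtain hv | hv := hv
  · exact h.endOff (hv ▸ hE.mem_left h₁)
  · exact hE.not_from_target hv h₁
  · have := h.index_unique_of_notMem hi.le le_rfl (hv.symm ▸ h.endOff) (by simpa using hv)
    omega
  · obtain ⟨k, rfl, hk⟩ := h.exists_of_new hi (hTF hv) h₁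
    exact hE.not_from_target hv hk

theorem exists_diffStep_out (h : Alternates E F A B W) (hE : IsLinearSystem E F S T)
    {v : V} (hv : (v = x ∨ v ∈ S) ∨ ∃ u, DiffStep E W u v) (hSF : S ⊆ F) :
    (v = y ∨ v ∈ T) ∨ ∃ w, DiffStep E W v w := by
  by_contra! hcon
  obtain ⟨⟨hy, hT⟩, hout⟩ := hcon
  have next : ∀ i, i ≤ W.length → W.getVert i = v → i < W.length := fun i hi hiv =>
    lt_of_le_of_ne hi fun heq => hy (by rw [← hiv, heq, W.getVert_length])
  by_cases hF : v ∈ F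
  · obtain hT' | ⟨w, hw⟩ := hE.succ hF
    · exact hT hT'
    have hwv : W.Step w v := by_contra fun hwv => hout w (.inl ⟨hw, hwv⟩)
    obtain ⟨i, hi, rfl, rfl⟩ := hwv
    have hi' := next _ hi rfl
    have hz : E (W.getVert (i + 2)) (W.getVert (i + 1)) :=
      by_contra fun hz => hout _ (.inr ⟨⟨i + 1, hi', rfl, rfl⟩, hz⟩)
    obtain (hx | hS) | ⟨u, ⟨h₁, h₂⟩ | ⟨⟨j, hj, rfl, hij⟩, h₁⟩⟩ := hv
    · exact h.startOff (hx ▸ hF)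
    · exact hE.not_to_source hS hz
    · exact h₂ ⟨i + 1, hi', rfl, hE.leftUnique hz h₁⟩
    · obtain ⟨hj', hj''⟩ := h.follows_index hj (hij ▸ hF) (hij ▸ h₁)
      have := h.trail.index_unique hi' hj' (by rw [hij, hE.leftUnique hz (hij ▸ hj'')])
      obtain rfl : i = j := by omega
      exact h₁ hw
  · have hi : ∃ i ≤ W.length, W.getVert i = v := by
      obtain (rfl | hS) | ⟨u, ⟨h₁, -⟩ | ⟨⟨j, hj, rfl, hij⟩, -⟩⟩ := hv
      · exact ⟨0, by simp⟩
      · exact absurd (hSF hS) hF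
      · exact absurd (hE.mem_right h₁) hF
      · exact ⟨j + 1, hj, hij⟩
    obtain ⟨i, hi, rfl⟩ := hi
    exact hout _ (.inr ⟨⟨i, next i hi rfl, rfl, rfl⟩, fun hw => hF (hE.mem_right hw)⟩)

theorem exists_diffStep_in (h : Alternates E F A B W) (hE : IsLinearSystem E F S T)
    {v w : V} (hw : DiffStep E W v w) : (v = x ∨ v ∈ S) ∨ ∃ u, DiffStep E W u v := by
  by_contra! hcon
  obtain ⟨⟨hx, hS⟩, hin⟩ := hcon
  have prev : ∀ i, W.getVert i = v → ∃ k, i = k + 1 := by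
    rintro (_ | k) hk
    · exact absurd (by simpa using hk.symm) hx
    · exact ⟨k, rfl⟩
  by_cases hF : v ∈ F
  · obtain hS' | ⟨u, hu⟩ := hE.pred hF
    · exact hS hS'
    have huv : W.Step v u := by_contra fun huv => hin u (.inl ⟨hu, huv⟩)
    obtain ⟨i, hi, rfl, rfl⟩ := huv
    obtain ⟨k, rfl⟩ := prev i rfl
    have hz : E (W.getVert (k + 1)) (W.getVert k) :=
      by_contra fun hz => hin _ (.inr ⟨⟨k, by omega, rfl, rfl⟩, hz⟩)
    obtain ⟨h₁, h₂⟩ | ⟨⟨j, hj, hij, rfl⟩, h₁⟩ := hw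
    · exact h₂ ⟨k, by omega, hE.rightUnique hz h₁, rfl⟩
    · obtain ⟨l, rfl, hl⟩ := h.exists_of_new hj (hij ▸ hF) (hij ▸ h₁)
      have := h.trail.index_unique (i := k) (j := l) (by omega) (by omega)
        (by rw [hij, hE.rightUnique hz (hij ▸ hl)])
      subst this
      exact h₁ hu
  · obtain ⟨h₁, -⟩ | ⟨⟨j, hj, rfl, rfl⟩, h₁⟩ := hw
    · exact hF (hE.mem_left h₁)
    · obtain ⟨k, rfl⟩ := prev j rfl
      exact hin _ (.inr ⟨⟨k, by omega, rfl, rfl⟩, fun hw => hF (hE.mem_left hw)⟩)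

theorem splice (h : Alternates E F A B W) (hE : IsLinearSystem E F S T)
    (hadj : ∀ {u v}, E u v → G.Adj u v) {i k : ℕ} (hki : k < i) (hi : i < W.length)
    (hnew : ¬ E (W.getVert (i + 1)) (W.getVert i)) (hk : E (W.getVert (k + 1)) (W.getVert k))
    (hreach : ReflTransGen (KeptStep E W) (W.getVert (i + 1)) (W.getVert (k + 1))) :
    ∃ W' : G.Walk x y, Alternates E F A B W' ∧ newCount E W' < newCount E W := by
  obtain ⟨Q, hQ⟩ := SimpleGraph.Walk.exists_obeys_of_reflTransGen (G := G)
    (fun u v huv => hadj huv.1) hreach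
  have hQpath : Q.IsPath := hQ.isPath fun v hv =>
    hE.acyclic v (TransGen.mono (fun _ _ h => h.1) v v hv)
  have hQE : ∀ d ∈ Q.reverse.darts, E d.snd d.fst := fun d hd =>
    (hQ _ (SimpleGraph.Walk.mem_darts_reverse.1 hd)).1
  have hlast : ∀ d ∈ (W.darts.take (k + 1)).getLast?, E d.snd d.fst := by
    intro d hd
    have hk' : k < W.darts.length := by simp; omega
    rw [List.take_succ_eq_append_getElem hk', List.getLast?_concat, Option.mem_def,
      Option.some_inj] at hd
    subst hd
    simpa [SimpleGraph.Walk.darts_getElem_eq_getVert] using hk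
  have hsub : ((W.take (k + 1)).darts ++ (W.drop (i + 1)).darts).Sublist W.darts := by
    rw [SimpleGraph.Walk.darts_take, SimpleGraph.Walk.darts_drop]
    conv_rhs => rw [← List.take_append_drop (i + 1) W.darts]
    exact .append (List.take_sublist_take_left (by omega)) (.refl _)
  have hQW : ∀ d ∈ Q.reverse.darts, d.edge ∉ W.edges := by
    intro d hd hmem
    have hd' := hQ _ (SimpleGraph.Walk.mem_darts_reverse.1 hd)
    obtain hs | hs := SimpleGraph.Walk.mem_edges_iff_step.1 (show s(d.fst, d.snd) ∈ W.edges from hmem)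
    · exact hd'.2 hs
    · exact h.not_step hd'.1 hs
  have hdarts : (((W.take (k + 1)).append Q.reverse).append (W.drop (i + 1))).darts =
      ((W.take (k + 1)).darts ++ Q.reverse.darts) ++ (W.drop (i + 1)).darts := by
    simp only [SimpleGraph.Walk.darts_append]
  have hperm : (((W.take (k + 1)).append Q.reverse).append (W.drop (i + 1))).darts.Perm
      (((W.take (k + 1)).darts ++ (W.drop (i + 1)).darts) ++ Q.reverse.darts) := by
    rw [hdarts, List.append_assoc, List.append_assoc]
    exact List.perm_append_comm.append_left _
  refine ⟨((W.take (k + 1)).append Q.reverse).append (W.drop (i + 1)), ?_, ?_⟩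
  · refine ⟨?_, h.startA, h.startOff, h.endB, h.endOff, ?_, ?_, ?_⟩
    · rw [SimpleGraph.Walk.isTrail_def, SimpleGraph.Walk.edges_eq_map_darts,
        (hperm.map _).nodup_iff, List.map_append, List.nodup_append]
      refine ⟨(hsub.map _).nodup ?_, ?_, ?_⟩
      · rw [← SimpleGraph.Walk.edges_eq_map_darts]
        exact h.trail.edges_nodup
      · rw [← SimpleGraph.Walk.edges_eq_map_darts]
        exact hQpath.reverse.isTrail.edges_nodup
      · rintro e he _ he' rfl
        obtain ⟨d, hd, rfl⟩ := List.mem_map.1 he'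
        refine hQW d hd ?_
        rw [SimpleGraph.Walk.edges_eq_map_darts]
        exact (hsub.map _).subset he
    · intro v hv
      by_contra hvF
      refine hvF (h.repeats v ?_)
      rw [← SimpleGraph.Walk.cons_map_snd_darts, List.duplicate_iff_sublist] at hv ⊢
      refine List.Sublist.trans ?_ ((hsub.map _).cons_cons x)
      classical
      have := hv.filter fun v => decide (v ∉ F)
      rw [hdarts, List.map_append, List.map_append, ← List.cons_append, ← List.cons_append,
        List.filter_append, List.filter_append,
        List.filter_eq_nil_iff (l := Q.reverse.darts.map _) |>.2] at this
      · rw [List.append_nil, ← List.filter_append, List.cons_append, ← List.map_append] at this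
        simpa [hvF] using this.trans List.filter_sublist
      · intro w hw
        obtain ⟨d, hd, rfl⟩ := List.mem_map.1 hw
        simpa using hE.mem_left (hQE d hd)
    · rw [hdarts, List.isChain_append, List.isChain_append, SimpleGraph.Walk.darts_take,
        SimpleGraph.Walk.darts_drop]
      refine ⟨⟨h.follows.take _, List.isChain_iff_getElem.2 fun j hj _ hne =>
        absurd (hQE _ (List.getElem_mem _)) hne, fun d hd _ _ _ hne => absurd (hlast d hd) hne⟩,
        h.follows.drop _, fun d hd _ _ _ hne => absurd ?_ hne⟩
      rw [List.getLast?_append, Option.mem_def, Option.or_eq_some_iff] at hd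
      obtain hd | ⟨-, hd⟩ := hd
      · exact hQE d (List.mem_of_getLast? hd)
      · exact hlast d hd
    · intro d hd hd'
      rw [hperm.mem_iff, List.mem_append] at hd
      obtain hd | hd := hd
      · exact h.backward d (hsub.subset hd) hd'
      · exact hE.acyclic _ (.tail (.single hd') (hQE d hd))
  · have hi' : i < W.darts.length := by simpa using hi
    unfold newCount
    rw [hperm.countP_eq, List.countP_append, List.countP_append, SimpleGraph.Walk.darts_take,
      SimpleGraph.Walk.darts_drop,
      List.countP_eq_zero (l := Q.reverse.darts) |>.2 (by simpa using hQE)]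
    conv_rhs => rw [← List.take_append_drop (i + 1) W.darts]
    rw [List.countP_append, List.take_succ_eq_append_getElem hi', List.countP_append,
      List.countP_singleton,
      if_pos (by simpa [SimpleGraph.Walk.darts_getElem_eq_getVert] using hnew)]
    classical
    have := (List.take_sublist_take_left (l := W.darts) (i := k + 1) (j := i) hki).countP_le
      (p := fun d => decide (¬ E d.snd d.fst))
    omega

theorem append_left (h : Alternates E F A B W) (hE : IsLinearSystem E F S T) {v : V}
    {p : G.Walk x v} {q : G.Walk v y} (hpq : W = p.append q) (hvB : v ∈ B) (hvF : v ∉ F)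
    (hq : v ≠ y) : Alternates E F A B p ∧ newCount E p < newCount E W := by
  subst hpq
  have hf := h.follows
  rw [SimpleGraph.Walk.darts_append] at hf
  refine ⟨⟨h.trail.of_append_left, h.startA, h.startOff, hvB, hvF, fun w hw => h.repeats w ?_,
    hf.left_of_append, fun d hd => h.backward d (by simp [hd])⟩, ?_⟩
  · rw [SimpleGraph.Walk.support_append]
    exact hw.mono_sublist (List.sublist_append_left _ _)
  · unfold newCount
    rw [SimpleGraph.Walk.darts_append, List.countP_append, Nat.lt_add_right_iff_pos,
      List.countP_pos_iff]
    cases q with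
    | nil => exact absurd rfl hq
    | cons hadj q => exact ⟨⟨(v, _), hadj⟩, by simp, by simpa using fun hE' => hvF (hE.mem_right hE')⟩

theorem append_right (h : Alternates E F A B W) (hE : IsLinearSystem E F S T) {v : V}
    {p : G.Walk x v} {q : G.Walk v y} (hpq : W = p.append q) (hvA : v ∈ A) (hvF : v ∉ F)
    (hp : v ≠ x) : Alternates E F A B q ∧ newCount E q < newCount E W := by
  subst hpq
  have hf := h.follows
  rw [SimpleGraph.Walk.darts_append] at hf
  refine ⟨⟨h.trail.of_append_right, hvA, hvF, h.endB, h.endOff, fun w hw => h.repeats w ?_,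
    hf.right_of_append, fun d hd => h.backward d (by simp [hd])⟩, ?_⟩
  · rw [SimpleGraph.Walk.support_append_eq_support_dropLast_append]
    exact hw.mono_sublist (List.sublist_append_right _ _)
  · unfold newCount
    rw [SimpleGraph.Walk.darts_append, List.countP_append, Nat.lt_add_left_iff_pos,
      List.countP_pos_iff]
    cases p with
    | nil => exact absurd rfl hp
    | cons hadj p =>
      exact ⟨⟨(x, _), hadj⟩, by simp, by simpa using fun hE' => h.startOff (hE.mem_right hE')⟩

theorem lt_of_tracks (h : Alternates E F A B W) (hmin : IsMinimalAlternating E F A B W)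
    (hE : IsLinearSystem E F S T) (hadj : ∀ {u v}, E u v → G.Adj u v) {i j : ℕ}
    (hj : j < W.length) (ht : Tracks E W i (W.getVert j))
    (hnew : ¬ E (W.getVert (j + 1)) (W.getVert j)) : i < j := by
  obtain ⟨hi, hnew', hreach⟩ := ht
  by_cases hF : W.getVert j ∈ F
  · obtain ⟨k, rfl, hk⟩ := h.exists_of_new hj hF hnew
    by_contra hle
    obtain ⟨W', hW', hlt⟩ := h.splice hE hadj (by omega : k < i) hi hnew' hk hreach
    exact (hmin W' hW').not_gt hlt
  · obtain heq | ⟨u, -, hu⟩ := hreach.cases_tail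
    · have := h.index_unique_of_notMem hj.le hi hF heq
      omega
    · exact absurd (hE.mem_right hu.1) hF

theorem exists_tracks (h : Alternates E F A B W) (hmin : IsMinimalAlternating E F A B W)
    (hE : IsLinearSystem E F S T) (hadj : ∀ {u v}, E u v → G.Adj u v) {i : ℕ} {v w : V}
    (ht : Tracks E W i v) (hvw : ReflTransGen (DiffStep E W) v w) :
    ∃ j, i ≤ j ∧ Tracks E W j w := by
  induction hvw with
  | refl => exact ⟨i, le_rfl, ht⟩
  | tail _ hs ih =>
    obtain ⟨j, hij, hj⟩ := ih
    obtain hs | ⟨⟨m, hm, rfl, rfl⟩, hs⟩ := hs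
    · exact ⟨j, hij, hj.1, hj.2.1, hj.2.2.tail hs⟩
    · have := h.lt_of_tracks hmin hE hadj hm hj hs
      exact ⟨m, by omega, hm, hs, .refl⟩

theorem diffStep_acyclic (h : Alternates E F A B W) (hmin : IsMinimalAlternating E F A B W)
    (hE : IsLinearSystem E F S T) (hadj : ∀ {u v}, E u v → G.Adj u v) (v : V) :
    ¬ TransGen (DiffStep E W) v v := by
  have split : ∀ {a b}, TransGen (DiffStep E W) a b → TransGen (KeptStep E W) a b ∨
      ∃ u u', ReflTransGen (DiffStep E W) a u ∧ NewStep E W u u' ∧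
        ReflTransGen (DiffStep E W) u' b := by
    intro a b hab
    induction hab with
    | single hs =>
      obtain hs | hs := hs
      · exact .inl (.single hs)
      · exact .inr ⟨_, _, .refl, hs, .refl⟩
    | tail hab hs ih =>
      obtain hk | ⟨u, u', h₁, h₂, h₃⟩ := ih
      · obtain hs | hs := hs
        · exact .inl (hk.tail hs)
        · exact .inr ⟨_, _, hab.to_reflTransGen, hs, .refl⟩
      · exact .inr ⟨u, u', h₁, h₂, h₃.tail hs⟩
  intro hv
  obtain hk | ⟨u, u', h₁, ⟨⟨i, hi, rfl, rfl⟩, h₂⟩, h₃⟩ := split hv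
  · exact hE.acyclic v (TransGen.mono (fun _ _ h => h.1) v v hk)
  · obtain ⟨j, hij, hj⟩ := h.exists_tracks hmin hE hadj ⟨hi, h₂, .refl⟩ (h₃.trans h₁)
    exact absurd (h.lt_of_tracks hmin hE hadj hi hj h₂) (by omega)

theorem pairwise_of_obeys (h : Alternates E F A B W) (hmin : IsMinimalAlternating E F A B W)
    (hE : IsLinearSystem E F S T) (hadj : ∀ {u v}, E u v → G.Adj u v) {s t : V}
    {p : G.Walk s t} (hp : p.Obeys (DiffStep E W)) :
    p.darts.Pairwise fun d d' => NewStep E W d.fst d.snd → NewStep E W d'.fst d'.snd →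
      ∃ i j : ℕ, i < j ∧ W.darts[i]? = some d ∧ W.darts[j]? = some d' := by
  induction p with
  | nil => simp
  | @cons a b c hab p ih =>
    simp only [SimpleGraph.Walk.Obeys, SimpleGraph.Walk.darts_cons, List.forall_mem_cons] at hp
    rw [SimpleGraph.Walk.darts_cons, List.pairwise_cons]
    refine ⟨?_, ih hp.2⟩
    rintro d hd ⟨⟨i, hi, h₁, h₂⟩, h₃⟩ ⟨⟨j, hj, h₄, h₅⟩, h₆⟩
    simp only at h₁ h₂ h₃
    subst h₁ h₂
    obtain ⟨m, him, hm⟩ := h.exists_tracks hmin hE hadj ⟨hi, h₃, .refl⟩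
      (SimpleGraph.Walk.Obeys.reflTransGen hp.2 (p.dart_fst_mem_support_of_mem_darts hd))
    rw [← h₄] at hm
    rw [← h₄, ← h₅] at h₆
    have := h.lt_of_tracks hmin hE hadj hj hm h₆
    refine ⟨i, j, by omega, ?_, ?_⟩
    · rw [List.getElem?_eq_getElem (by simpa using hi),
        SimpleGraph.Walk.darts_getElem_eq_getVert]
    · rw [List.getElem?_eq_getElem (by simpa using hj),
        SimpleGraph.Walk.darts_getElem_eq_getVert]
      exact congrArg some (SimpleGraph.Dart.ext _ _ (Prod.ext h₄ h₅))

theorem filter_darts_eq [DecidableEq V] (h : Alternates E F A B W)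
    (hmin : IsMinimalAlternating E F A B W) (hE : IsLinearSystem E F S T)
    (hadj : ∀ {u v}, E u v → G.Adj u v) {s t : V} {p : G.Walk s t}
    (hp : p.Obeys (DiffStep E W)) :
    p.darts.filter (fun d => d.edge ∈ W.edges) = W.darts.filter (fun d => d.edge ∈ p.edges) := by
  have hpath : p.IsPath := hp.isPath (h.diffStep_acyclic hmin hE hadj)
  have hnodup : W.darts.Nodup := List.Nodup.of_map _ <| by
    rw [← SimpleGraph.Walk.edges_eq_map_darts]
    exact h.trail.edges_nodup
  have hnew : ∀ d ∈ p.darts, d.edge ∈ W.edges → NewStep E W d.fst d.snd := by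
    intro d hd he
    refine (hp d hd).resolve_left fun hk => ?_
    exact (SimpleGraph.Walk.mem_edges_iff_step.1 (show s(d.fst, d.snd) ∈ W.edges from he)).elim
      (h.not_step hk.1) hk.2
  refine List.Perm.eq_of_pairwise
    (le := fun d d' => ∃ i j : ℕ, i < j ∧ W.darts[i]? = some d ∧ W.darts[j]? = some d') ?_ ?_ ?_ ?_
  · rintro a b - - ⟨i, j, hij, hi, hj⟩ ⟨i', j', hij', hi', hj'⟩
    have hinj : ∀ {m n : ℕ} {d : G.Dart}, W.darts[m]? = some d → W.darts[n]? = some d →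
        m = n := by
      intro m n d hm hn
      obtain ⟨hm, rfl⟩ := List.getElem?_eq_some_iff.1 hm
      obtain ⟨hn, he⟩ := List.getElem?_eq_some_iff.1 hn
      exact (hnodup.getElem_inj_iff.1 he).symm
    have := hinj hi hj'
    have := hinj hj hi'
    omega
  · refine ((h.pairwise_of_obeys hmin hE hadj hp).filter _).imp_of_mem ?_
    intro a b ha hb hab
    simp only [List.mem_filter, decide_eq_true_eq] at ha hb
    exact hab (hnew a ha.1 ha.2) (hnew b hb.1 hb.2)
  · refine List.Pairwise.filter _ (List.pairwise_iff_getElem.2 fun i j hi hj hij => ?_)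
    exact ⟨i, j, hij, List.getElem?_eq_getElem hi, List.getElem?_eq_getElem hj⟩
  · refine (List.perm_ext_iff_of_nodup (.filter _ ?_) (.filter _ hnodup)).2 fun d => ?_
    · exact SimpleGraph.Walk.darts_nodup_of_support_nodup hpath.support_nodup
    simp only [List.mem_filter, decide_eq_true_eq]
    constructor
    · rintro ⟨hd, he⟩
      exact ⟨SimpleGraph.Walk.mem_darts_iff_step.2 (hnew d hd he).1, List.mem_map_of_mem hd⟩
    · rintro ⟨hd, he⟩
      refine ⟨?_, List.mem_map_of_mem hd⟩
      rw [SimpleGraph.Walk.mem_darts_iff_step] at hd ⊢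
      refine (SimpleGraph.Walk.mem_edges_iff_step.1
        (show s(d.fst, d.snd) ∈ p.edges from he)).resolve_right fun hs => ?_
      obtain hk | hk := hp ⟨(d.snd, d.fst), d.adj.symm⟩ (SimpleGraph.Walk.mem_darts_iff_step.2 hs)
      · exact hk.2 hd
      · exact h.trail.not_step_symm hd hk.1

theorem eq_start_of_mem (h : Alternates E F A B W) (hmin : IsMinimalAlternating E F A B W)
    (hE : IsLinearSystem E F S T) {v : V} (hv : v ∈ W.support) (hvA : v ∈ A) (hvF : v ∉ F) :
    v = x := by
  obtain ⟨p, q, hpq⟩ := SimpleGraph.Walk.mem_support_iff_exists_append.1 hv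
  by_contra hne
  obtain ⟨h₁, h₂⟩ := h.append_right hE hpq hvA hvF hne
  exact (hmin q h₁).not_gt h₂

theorem eq_end_of_mem (h : Alternates E F A B W) (hmin : IsMinimalAlternating E F A B W)
    (hE : IsLinearSystem E F S T) {v : V} (hv : v ∈ W.support) (hvB : v ∈ B) (hvF : v ∉ F) :
    v = y := by
  obtain ⟨p, q, hpq⟩ := SimpleGraph.Walk.mem_support_iff_exists_append.1 hv
  by_contra hne
  obtain ⟨h₁, h₂⟩ := h.append_left hE hpq hvB hvF hne
  exact (hmin p h₁).not_gt h₂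

theorem diffStep_mem_left (hE : IsLinearSystem E F S T) {u v : V} (huv : DiffStep E W u v) :
    u ∈ F ∪ {v | v ∈ W.support} := by
  obtain huv | ⟨⟨i, hi, rfl, rfl⟩, -⟩ := huv
  · exact .inl (hE.mem_left huv.1)
  · exact .inr (W.getVert_mem_support i)

theorem diffStep_mem_right (hE : IsLinearSystem E F S T) {u v : V} (huv : DiffStep E W u v) :
    v ∈ F ∪ {v | v ∈ W.support} := by
  obtain huv | ⟨⟨i, hi, rfl, rfl⟩, -⟩ := huv
  · exact .inl (hE.mem_right huv.1)
  · exact .inr (W.getVert_mem_support _)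

theorem finite_union_support (hF : F.Finite) : (F ∪ {v | v ∈ W.support}).Finite :=
  hF.union (List.finite_toSet _)

theorem exists_source (h : Alternates E F A B W) (hmin : IsMinimalAlternating E F A B W)
    (hE : IsLinearSystem E F S T) (hadj : ∀ {u v}, E u v → G.Adj u v) (hF : F.Finite) {u v : V}
    (huv : DiffStep E W u v) : ∃ s, (s = x ∨ s ∈ S) ∧ ReflTransGen (DiffStep E W) s u :=
  exists_reflTransGen_source (S := insert x S) (finite_union_support hF)
    (h.diffStep_acyclic hmin hE hadj) (diffStep_mem_left hE) (h.exists_diffStep_in hE) huv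

theorem exists_path (h : Alternates E F A B W) (hmin : IsMinimalAlternating E F A B W)
    (hE : IsLinearSystem E F S T) (hadj : ∀ {u v}, E u v → G.Adj u v) (hF : F.Finite)
    (hSF : S ⊆ F) {s : V} (hs : s = x ∨ s ∈ S) :
    ∃ t, (t = y ∨ t ∈ T) ∧ ∃ p : G.Walk s t, p.Obeys (DiffStep E W) ∧ p.IsPath := by
  obtain ⟨t, ht, hst⟩ := exists_reflTransGen_target (T := insert y T) (finite_union_support hF)
    (h.diffStep_acyclic hmin hE hadj) (diffStep_mem_right hE)
    (fun huv => h.exists_diffStep_out hE (.inr ⟨_, huv⟩) hSF)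
    (h.exists_diffStep_out hE (.inl hs) hSF)
  obtain ⟨p, hp⟩ := SimpleGraph.Walk.exists_obeys_of_reflTransGen (G := G)
    (fun _ _ => diffStep_adj hadj) hst
  exact ⟨t, ht, p, hp, hp.isPath (h.diffStep_acyclic hmin hE hadj)⟩

end Alternates

/-- The successor relation of the directed paths of a family. -/
def familyStep {V : Type*} {G : SimpleGraph V} {A B : Set V} {k : ℕ} (P : Fin k → ABPath G A B)
    (u v : V) : Prop :=
  ∃ j, (P j).walk.Step u v

section Family

variable {V : Type*} {G : SimpleGraph V} {A B : Set V} {k : ℕ} {P : Fin k → ABPath G A B}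

theorem SimpleGraph.Walk.Step.left_mem {x y : V} {w : G.Walk x y} {u v : V} (h : w.Step u v) :
    u ∈ w.support := by
  obtain ⟨i, -, rfl, -⟩ := h
  exact w.getVert_mem_support i

theorem SimpleGraph.Walk.Step.right_mem {x y : V} {w : G.Walk x y} {u v : V} (h : w.Step u v) :
    v ∈ w.support := by
  obtain ⟨i, -, -, rfl⟩ := h
  exact w.getVert_mem_support _

theorem SimpleGraph.Walk.exists_getVert {x y : V} {w : G.Walk x y} {v : V} (h : v ∈ w.support) :
    ∃ i ≤ w.length, w.getVert i = v := by
  obtain ⟨i, h₁, h₂⟩ := SimpleGraph.Walk.mem_support_iff_exists_getVert.1 h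
  exact ⟨i, h₂, h₁⟩

theorem SimpleGraph.Walk.IsPath.index_unique {x y : V} {w : G.Walk x y} (hw : w.IsPath) {i j : ℕ}
    (hi : i ≤ w.length) (hj : j ≤ w.length) (h : w.getVert i = w.getVert j) : i = j :=
  hw.getVert_injOn hi hj h

theorem familyStep_adj {u v : V} (h : familyStep P u v) : G.Adj u v :=
  h.elim fun _ h => h.adj

theorem finite_familySupport (P : Fin k → ABPath G A B) : (familySupport P).Finite := by
  have : familySupport P = ⋃ j, {v | v ∈ (P j).walk.support} := by
    ext v
    simp [familySupport]
  rw [this]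
  exact Set.finite_iUnion fun j => List.finite_toSet _

theorem PathFamilyDisjoint.eq (hP : PathFamilyDisjoint P) {i j : Fin k} {v : V}
    (hi : v ∈ (P i).walk.support) (hj : v ∈ (P j).walk.support) : i = j :=
  by_contra fun hne => hP i j hne v hi hj

theorem PathFamilyDisjoint.isLinearSystem (hP : PathFamilyDisjoint P) :
    IsLinearSystem (familyStep P) (familySupport P) (Set.range fun j => (P j).first)
      (Set.range fun j => (P j).last) where
  rightUnique := by
    rintro u v v' ⟨i, hi⟩ ⟨j, hj⟩
    obtain rfl := hP.eq hi.left_mem hj.left_mem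
    obtain ⟨a, ha, rfl, rfl⟩ := hi
    obtain ⟨b, hb, hab, rfl⟩ := hj
    rw [(P i).isPath.index_unique hb.le ha.le hab]
  leftUnique := by
    rintro u u' v ⟨i, hi⟩ ⟨j, hj⟩
    obtain rfl := hP.eq hi.right_mem hj.right_mem
    obtain ⟨a, ha, rfl, rfl⟩ := hi
    obtain ⟨b, hb, rfl, hab⟩ := hj
    have := (P i).isPath.index_unique hb ha hab
    rw [show a = b by omega]
  acyclic := by
    have key : ∀ {u v}, TransGen (familyStep P) u v → ∃ j a b, a < b ∧ b ≤ (P j).walk.length ∧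
        (P j).walk.getVert a = u ∧ (P j).walk.getVert b = v := by
      intro u v h
      induction h with
      | single h =>
        obtain ⟨j, a, ha, rfl, rfl⟩ := h
        exact ⟨j, a, a + 1, by omega, ha, rfl, rfl⟩
      | tail _ h ih =>
        obtain ⟨j, a, b, hab, hb, rfl, rfl⟩ := ih
        obtain ⟨i, hi⟩ := h
        obtain rfl := hP.eq hi.left_mem ((P j).walk.getVert_mem_support b)
        obtain ⟨c, hc, hcb, rfl⟩ := hi
        obtain rfl := (P i).isPath.index_unique hc.le hb hcb
        exact ⟨i, a, c + 1, by omega, hc, rfl, rfl⟩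
    intro v hv
    obtain ⟨j, a, b, hab, hb, h₁, h₂⟩ := key hv
    have := (P j).isPath.index_unique (by omega) hb (h₁.trans h₂.symm)
    omega
  mem_left := fun ⟨j, hj⟩ => ⟨j, hj.left_mem⟩
  mem_right := fun ⟨j, hj⟩ => ⟨j, hj.right_mem⟩
  pred := by
    rintro v ⟨j, hj⟩
    obtain ⟨_ | a, ha, rfl⟩ := SimpleGraph.Walk.exists_getVert hj
    · exact .inl ⟨j, by simp⟩
    · exact .inr ⟨_, j, a, ha, rfl, rfl⟩
  succ := by
    rintro v ⟨j, hj⟩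
    obtain ⟨a, ha, rfl⟩ := SimpleGraph.Walk.exists_getVert hj
    obtain ha | rfl := ha.lt_or_eq
    · exact .inr ⟨_, j, a, ha, rfl, rfl⟩
    · exact .inl ⟨j, by simp⟩
  not_to_source := by
    rintro u _ ⟨j, rfl⟩ ⟨i, hi⟩
    obtain rfl := hP.eq hi.right_mem (P j).walk.start_mem_support
    obtain ⟨a, ha, rfl, h⟩ := hi
    have := (P i).isPath.index_unique ha (Nat.zero_le _) (by simpa using h)
    omega
  not_from_target := by
    rintro _ w ⟨j, rfl⟩ ⟨i, hi⟩
    obtain rfl := hP.eq hi.left_mem (P j).walk.end_mem_support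
    obtain ⟨a, ha, h, rfl⟩ := hi
    have := (P i).isPath.index_unique ha.le le_rfl (by simpa using h)
    omega

theorem IsAlternatingWalk.alternates {x y : V} {W : G.Walk x y} (h : IsAlternatingWalk P W)
    (hyB : y ∈ B) (hy : y ∉ familySupport P) :
    Alternates (familyStep P) (familySupport P) A B W where
  trail := h.trail
  startA := h.startA
  startOff := h.startOff
  endB := hyB
  endOff := hy
  repeats := h.repeats
  follows := by
    refine List.isChain_iff_getElem.2 fun i hi => ?_
    rintro ⟨j, hj⟩ hE
    obtain ⟨hi', h'⟩ := h.follows i (by omega) j hj fun he => hE ⟨j,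
      SimpleGraph.Walk.mem_darts_iff_step.1 (h.backward _ (List.get_mem _ _) j he)⟩
    exact ⟨j, SimpleGraph.Walk.mem_darts_iff_step.1 h'⟩
  backward := by
    rintro d hd ⟨j, hj⟩
    have := h.backward d hd j (SimpleGraph.Walk.mem_edges_iff_step.2 (.inl hj))
    exact (P j).isPath.isTrail.not_step_symm hj (SimpleGraph.Walk.mem_darts_iff_step.1 this)

theorem Alternates.isAlternatingWalk (hP : PathFamilyDisjoint P) {x y : V} {W : G.Walk x y}
    (h : Alternates (familyStep P) (familySupport P) A B W) : IsAlternatingWalk P W where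
  trail := h.trail
  startA := h.startA
  startOff := h.startOff
  repeats := h.repeats
  follows := by
    intro i hi j hj he
    have hi' : i < W.length := by simpa using hi
    simp only [List.get_eq_getElem, SimpleGraph.Walk.darts_getElem_eq_getVert] at hj he ⊢
    have hE : ¬ familyStep P (W.getVert (i + 1)) (W.getVert i) := by
      rintro ⟨l, hl⟩
      obtain rfl := hP.eq hl.left_mem hj
      exact he (SimpleGraph.Walk.mem_edges_iff_step.2 (.inr hl))
    obtain ⟨h₁, l, hl⟩ := h.follows_index hi' ⟨j, hj⟩ hE
    obtain rfl := hP.eq hl.right_mem hj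
    exact ⟨by simpa using h₁, SimpleGraph.Walk.mem_darts_iff_step.2 hl⟩
  backward := by
    intro d hd j he
    refine SimpleGraph.Walk.mem_darts_iff_step.2
      ((SimpleGraph.Walk.mem_edges_iff_step.1 he).resolve_left fun hs => ?_)
    exact h.backward d hd ⟨j, hs⟩

theorem exists_minimalAlternating {E : V → V → Prop} {F : Set V} {x y : V} {W : G.Walk x y}
    (h : Alternates E F A B W) : ∃ (x' y' : V) (W' : G.Walk x' y'), Alternates E F A B W' ∧
      IsMinimalAlternating E F A B W' := by
  classical
  have hex : ∃ n, ∃ (x' y' : V) (W' : G.Walk x' y'), Alternates E F A B W' ∧ newCount E W' = n :=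
    ⟨_, x, y, W, h, rfl⟩
  obtain ⟨x', y', W', h', hn⟩ := Nat.find_spec hex
  exact ⟨x', y', W', h', fun a b W'' h'' => hn ▸ Nat.find_min' hex ⟨a, b, W'', h'', rfl⟩⟩

theorem mem_familyEdges_iff {u v : V} :
    s(u, v) ∈ familyEdges P ↔ familyStep P u v ∨ familyStep P v u := by
  simp only [familyEdges, Set.mem_ofPred_eq, SimpleGraph.Walk.mem_edges_iff_step, familyStep,
    exists_or]

theorem Alternates.familyEdges_eq (hP : PathFamilyDisjoint P) {x y : V} {W : G.Walk x y}
    (h : Alternates (familyStep P) (familySupport P) A B W) {l : ℕ} {P' : Fin l → ABPath G A B}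
    (hP' : ∀ u v, familyStep P' u v ↔ DiffStep (familyStep P) W u v) :
    familyEdges P' = symmDiff (familyEdges P) {e | e ∈ W.edges} := by
  ext e
  induction e with | h u v => ?_
  have hE : ∀ {a b}, familyStep P a b → ¬ familyStep P b a := fun h₁ h₂ =>
    hP.isLinearSystem.acyclic _ (.tail (.single h₁) h₂)
  have h₁ : familyStep P u v → ¬ familyStep P v u := hE
  have h₂ : familyStep P u v → ¬ W.Step u v := h.not_step
  have h₃ : familyStep P v u → ¬ W.Step v u := h.not_step
  have h₄ : W.Step u v → ¬ W.Step v u := h.trail.not_step_symm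
  rw [Set.mem_symmDiff, mem_familyEdges_iff, mem_familyEdges_iff, Set.mem_ofPred_eq,
    SimpleGraph.Walk.mem_edges_iff_step, hP', hP']
  unfold DiffStep KeptStep NewStep
  tauto

end Family

/-- If some walk alternating with respect to a family `P` of `k` pairwise
disjoint `A`–`B` paths ends in `B ∖ V(⋃P)`, then `G` contains `k+1` pairwise disjoint
`A`–`B` paths. Moreover, the alternating walk `W` can be chosen so that the edge set of
the new family is exactly `E(P) △ E(W)`, and every new path traverses its edges shared
with `W` in the same order (and direction) as `W` does. -/
theorem statement4 {V : Type*} [DecidableEq V] (G : SimpleGraph V) (A B : Set V)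
    (k : ℕ) (P : Fin k → ABPath G A B) (hP : PathFamilyDisjoint P)
    (hW : ∃ (x y : V) (W : G.Walk x y),
      IsAlternatingWalk P W ∧ y ∈ B ∧ y ∉ familySupport P) :
    ∃ (x y : V) (W : G.Walk x y),
      IsAlternatingWalk P W ∧ y ∈ B ∧ y ∉ familySupport P ∧
      ∃ P' : Fin (k + 1) → ABPath G A B, PathFamilyDisjoint P' ∧
        familyEdges P' = symmDiff (familyEdges P) {e | e ∈ W.edges} ∧
        ∀ j : Fin (k + 1),
          (P' j).walk.darts.filter (fun d => d.edge ∈ W.edges) =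
            W.darts.filter (fun d => d.edge ∈ (P' j).walk.edges) := by
  obtain ⟨x₀, y₀, W₀, h₀, hy₀B, hy₀⟩ := hW
  obtain ⟨x, y, W, h, hmin⟩ := exists_minimalAlternating (h₀.alternates hy₀B hy₀)
  have hE := hP.isLinearSystem
  have hadj : ∀ {u v}, familyStep P u v → G.Adj u v := familyStep_adj
  have hSF : (Set.range fun j => (P j).first) ⊆ familySupport P := by
    rintro _ ⟨j, rfl⟩
    exact ⟨j, (P j).walk.start_mem_support⟩
  have hTF : (Set.range fun j => (P j).last) ⊆ familySupport P := by
    rintro _ ⟨j, rfl⟩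
    exact ⟨j, (P j).walk.end_mem_support⟩
  have hacyc := h.diffStep_acyclic hmin hE hadj
  let start : Fin (k + 1) → V := Fin.cons x fun j => (P j).first
  have hstart : ∀ s, (s = x ∨ s ∈ Set.range fun j => (P j).first) ↔ ∃ j, start j = s := by
    intro s
    simp [start, Fin.exists_fin_succ, eq_comm]
  have hinj : Function.Injective start := by
    refine Fin.cons_injective_iff.2 ⟨fun hx => h.startOff (hSF hx), fun i j hij => ?_⟩
    have hij' : (P i).first = (P j).first := hij
    exact hP.eq (P i).walk.start_mem_support (by rw [hij']; exact (P j).walk.start_mem_support)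
  choose t ht p hp hpath using fun j =>
    h.exists_path hmin hE hadj (finite_familySupport P) hSF ((hstart _).2 ⟨j, rfl⟩)
  have hleft : ∀ {u u' v}, DiffStep (familyStep P) W u v → DiffStep (familyStep P) W u' v →
      u = u' := h.diffStep_leftUnique hE
  have hright : ∀ {u v v'}, DiffStep (familyStep P) W u v → DiffStep (familyStep P) W u v' →
      v = v' := h.diffStep_rightUnique hE
  have hsrc : ∀ j u, ¬ DiffStep (familyStep P) W u (start j) := fun j u =>
    h.not_diffStep_source hE hSF ((hstart _).2 ⟨j, rfl⟩)
  have htgt : ∀ j w, ¬ DiffStep (familyStep P) W (t j) w := fun j w =>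
    h.not_diffStep_target hE hTF (ht j)
  have hmemA : ∀ j v, v ∈ (p j).support → v ∈ A → v = start j := by
    intro j v hv hvA
    obtain heq | ⟨d, hd, rfl⟩ := SimpleGraph.Walk.exists_dart_snd hv
    · exact heq
    refine absurd (hp j d hd) (h.not_diffStep_source hE hSF ?_)
    by_cases hF : d.snd ∈ familySupport P
    · obtain ⟨i, hi⟩ := hF
      exact .inr ⟨i, ((P i).meetA _ hi hvA).symm⟩
    · exact .inl (h.eq_start_of_mem hmin hE
        ((Alternates.diffStep_mem_right hE (hp j d hd)).resolve_left hF) hvA hF)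
  have hmemB : ∀ j v, v ∈ (p j).support → v ∈ B → v = t j := by
    intro j v hv hvB
    obtain heq | ⟨d, hd, rfl⟩ := SimpleGraph.Walk.exists_dart_fst hv
    · exact heq
    refine absurd (hp j d hd) (h.not_diffStep_target hE hTF ?_)
    by_cases hF : d.fst ∈ familySupport P
    · obtain ⟨i, hi⟩ := hF
      exact .inr ⟨i, ((P i).meetB _ hi hvB).symm⟩
    · exact .inl (h.eq_end_of_mem hmin hE
        ((Alternates.diffStep_mem_left hE (hp j d hd)).resolve_left hF) hvB hF)
  let P' : Fin (k + 1) → ABPath G A B := fun j =>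
    { first := start j
      last := t j
      walk := p j
      isPath := hpath j
      firstA := by
        obtain hj | ⟨i, hi⟩ := (hstart _).2 ⟨j, rfl⟩
        · exact hj ▸ h.startA
        · exact hi ▸ (P i).firstA
      lastB := by
        obtain hj | ⟨i, hi⟩ := ht j
        · exact hj ▸ h.endB
        · exact hi ▸ (P i).lastB
      meetA := hmemA j
      meetB := hmemB j }
  refine ⟨x, y, W, h.isAlternatingWalk hP, h.endB, h.endOff, P', ?_, ?_, fun j =>
    h.filter_darts_eq hmin hE hadj (hp j)⟩
  · intro i j hij v hi hj
    exact hij (hinj (ReflTransGen.unique_source (R := DiffStep (familyStep P) W) hleft (hsrc i)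
      (hsrc j) ((hp i).reflTransGen hi) ((hp j).reflTransGen hj)))
  · refine h.familyEdges_eq hP fun u v => ⟨?_, fun huv => ?_⟩
    · rintro ⟨j, hj⟩
      exact hp j ⟨(u, v), hj.adj⟩ (SimpleGraph.Walk.mem_darts_iff_step.2 hj)
    · obtain ⟨s, hs, hsu⟩ := h.exists_source hmin hE hadj (finite_familySupport P) huv
      obtain ⟨j, rfl⟩ := (hstart s).1 hs
      have hu : u ∈ (p j).support :=
        ReflTransGen.mem_support (R := DiffStep (familyStep P) W) hright (hp j) (htgt j) hsu
      obtain rfl | ⟨d, hd, rfl⟩ := SimpleGraph.Walk.exists_dart_fst hu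
      · exact absurd huv (htgt j _)
      · rw [hright huv (hp j d hd)]
        exact ⟨j, SimpleGraph.Walk.mem_darts_iff_step.1 hd⟩
end

section
/- Let G be a (potentially infinite) k-connected graph, let A and B be disjoint sets of vertices each of size at least k, and let 𝒫 be a set of pairwise disjoint A–B paths with |𝒫| = i < k. Then there exists a walk W, alternating with respect to 𝒫 and ending in B ∖ V(⋃𝒫), such that the symmetric difference E(𝒫) △ E(W) is precisely the edge set of a family of i+1 pairwise disjoint A–B paths. -/
open Topology

namespace Augment

section PathSystem

variable {V : Type*}

/-- The directed edges `S` and the vertices `U` of a system of disjoint `A`–`B` paths, together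
with a function `pos` that increases along the paths. -/
structure IsPathSystem (G : SimpleGraph V) (A B : Set V) (S : V → V → Prop) (U : Set V)
    (pos : V → ℕ) : Prop where
  adj : ∀ {u v}, S u v → G.Adj u v
  right_unique : ∀ {u v w}, S u v → S u w → v = w
  left_unique : ∀ {u v w}, S u w → S v w → u = v
  pos_lt : ∀ {u v}, S u v → pos u < pos v
  mem_left : ∀ {u v}, S u v → u ∈ U
  mem_right : ∀ {u v}, S u v → v ∈ U
  notMem_A : ∀ {u v}, S u v → v ∉ A
  notMem_B : ∀ {u v}, S u v → u ∉ B
  exists_pred : ∀ {v}, v ∈ U → v ∉ A → ∃ u, S u v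
  exists_succ : ∀ {v}, v ∈ U → v ∉ B → ∃ w, S v w

/-- Each vertex is split into an entry port and an exit port. -/
inductive Port (V : Type*)
  | inn (v : V)
  | out (v : V)

open Port

/-- Steps of the residual digraph that use no edge outside the path system. -/
inductive FreeStep (S : V → V → Prop) (U : Set V) : Port V → Port V → Prop
  | pass {v : V} (h : v ∉ U) : FreeStep S U (inn v) (out v)
  | back {u v : V} (h : S u v) : FreeStep S U (inn v) (out u)
  | turn {v : V} (h : v ∈ U) : FreeStep S U (out v) (inn v)

/-- Steps of the residual digraph along an edge outside the path system. -/
inductive NewStep (G : SimpleGraph V) (S : V → V → Prop) : Port V → Port V → Prop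
  | mk {u v : V} (h : G.Adj u v) (h₁ : ¬ S u v) (h₂ : ¬ S v u) : NewStep G S (out u) (inn v)

/-- `Reach G A S U n s`: the port `s` can be reached from an entry port of `A ∖ U` using exactly
`n` edges outside the path system. -/
inductive Reach (G : SimpleGraph V) (A : Set V) (S : V → V → Prop) (U : Set V) :
    ℕ → Port V → Prop
  | start {x : V} (hx : x ∈ A) (hU : x ∉ U) : Reach G A S U 0 (inn x)
  | free {n : ℕ} {s t : Port V} (h : Reach G A S U n s) (hst : FreeStep S U s t) :
      Reach G A S U n t
  | new {n : ℕ} {s t : Port V} (h : Reach G A S U n s) (hst : NewStep G S s t) :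
      Reach G A S U (n + 1) t

/-- A shortest augmenting path `σ 0, …, σ m` in the residual digraph, with respect to the
potential `d`. -/
structure IsTightPath (G : SimpleGraph V) (A B : Set V) (S : V → V → Prop) (U : Set V)
    (d : Port V → ℕ) (M : ℕ) (x y : V) (m : ℕ) (σ : ℕ → Port V) : Prop where
  start : σ 0 = inn x
  start_mem : x ∈ A
  start_notMem : x ∉ U
  last : σ m = out y
  last_mem : y ∈ B
  last_notMem : y ∉ U
  step : ∀ l < m, (FreeStep S U (σ l) (σ (l + 1)) ∧ d (σ (l + 1)) = d (σ l)) ∨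
    (NewStep G S (σ l) (σ (l + 1)) ∧ d (σ (l + 1)) = d (σ l) + 1)
  free_le : ∀ {s t}, FreeStep S U s t → d t ≤ d s
  le_bound : ∀ s, d s ≤ M
  d_start : ∀ a ∈ A, a ∉ U → d (inn a) = 0
  d_last : ∀ b ∈ B, b ∉ U → M ≤ d (out b)

theorem exists_tightPath_to {G : SimpleGraph V} {A : Set V} {S : V → V → Prop} {U : Set V}
    {d : Port V → ℕ} (hd : ∀ n s, Reach G A S U n s → d s ≤ n)
    (hfree : ∀ s t, FreeStep S U s t → d t ≤ d s)
    (hnew : ∀ s t, NewStep G S s t → d t ≤ d s + 1)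
    {n : ℕ} {s : Port V} (h : Reach G A S U n s) (hn : n ≤ d s) :
    ∃ (x : V) (m : ℕ) (σ : ℕ → Port V), σ 0 = inn x ∧ x ∈ A ∧ x ∉ U ∧ σ m = s ∧
      ∀ l < m, (FreeStep S U (σ l) (σ (l + 1)) ∧ d (σ (l + 1)) = d (σ l)) ∨
        (NewStep G S (σ l) (σ (l + 1)) ∧ d (σ (l + 1)) = d (σ l) + 1) := by
  induction h with
  | @start x hx hU => exact ⟨x, 0, fun _ => inn x, rfl, hx, hU, rfl, by simp⟩
  | @free n s t h hst ih =>
    have h1 := hfree _ _ hst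
    have h2 := hd _ _ h
    obtain ⟨x, m, σ, h0, hx, hU, hm, hs⟩ := ih (by omega)
    refine ⟨x, m + 1, fun l => if l ≤ m then σ l else t, by simp [h0], hx, hU, by simp, ?_⟩
    intro l hl
    rcases Nat.lt_succ_iff_lt_or_eq.1 hl with hl | rfl
    · simpa [hl.le, Nat.succ_le_of_lt hl] using hs l hl
    · left
      simp only [le_refl, if_true, Nat.not_succ_le_self, if_false, hm]
      exact ⟨hst, by omega⟩
  | @new n s t h hst ih =>
    have h1 := hnew _ _ hst
    have h2 := hd _ _ h
    obtain ⟨x, m, σ, h0, hx, hU, hm, hs⟩ := ih (by omega)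
    refine ⟨x, m + 1, fun l => if l ≤ m then σ l else t, by simp [h0], hx, hU, by simp, ?_⟩
    intro l hl
    rcases Nat.lt_succ_iff_lt_or_eq.1 hl with hl | rfl
    · simpa [hl.le, Nat.succ_le_of_lt hl] using hs l hl
    · right
      simp only [le_refl, if_true, Nat.not_succ_le_self, if_false, hm]
      exact ⟨hst, by omega⟩

theorem exists_isTightPath {G : SimpleGraph V} {A B : Set V} {S : V → V → Prop} {U : Set V}
    (h : ∃ b ∈ B, b ∉ U ∧ ∃ n, Reach G A S U n (out b)) :
    ∃ d M x y m σ, IsTightPath G A B S U d M x y m σ := by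
  classical
  have hex : ∃ n, ∃ b ∈ B, b ∉ U ∧ Reach G A S U n (out b) := by
    obtain ⟨b, hb, hU, n, hn⟩ := h
    exact ⟨n, b, hb, hU, hn⟩
  set M := Nat.find hex with hM
  obtain ⟨y, hy, hyU, hyM⟩ := Nat.find_spec hex
  have hmin : ∀ n, ∀ b ∈ B, b ∉ U → Reach G A S U n (out b) → M ≤ n := fun n b hb hU hn =>
    Nat.find_min' hex ⟨b, hb, hU, hn⟩
  have hex' : ∀ s, ∃ n, Reach G A S U n s ∨ n = M := fun s => ⟨M, Or.inr rfl⟩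
  set d : Port V → ℕ := fun s => Nat.find (hex' s) with hd
  have hspec : ∀ s, Reach G A S U (d s) s ∨ d s = M := fun s => Nat.find_spec (hex' s)
  have hle : ∀ n s, Reach G A S U n s → d s ≤ n := fun n s h => Nat.find_min' (hex' s) (Or.inl h)
  have hleM : ∀ s, d s ≤ M := fun s => Nat.find_min' (hex' s) (Or.inr rfl)
  have hfree : ∀ s t, FreeStep S U s t → d t ≤ d s := fun s t hst => by
    rcases hspec s with h | h
    · exact hle _ _ (h.free hst)
    · exact h ▸ hleM t
  have hnew : ∀ s t, NewStep G S s t → d t ≤ d s + 1 := fun s t hst => by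
    rcases hspec s with h | h
    · exact hle _ _ (h.new hst)
    · exact h ▸ (hleM t).trans (Nat.le_succ _)
  have hlast : ∀ b ∈ B, b ∉ U → M ≤ d (out b) := fun b hb hU => by
    rcases hspec (out b) with h | h
    · exact hmin _ b hb hU h
    · exact h.ge
  obtain ⟨x, m, σ, h0, hx, hxU, hm, hs⟩ :=
    exists_tightPath_to hle hfree hnew hyM (hlast y hy hyU)
  exact ⟨d, M, x, y, m, σ, h0, hx, hxU, hm, hy, hyU, hs, fun h => hfree _ _ h, hleM,
    fun a ha hU => Nat.le_zero.1 (hle _ _ (Reach.start ha hU)), hlast⟩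

/-- Consecutive ports of the path `σ 0, …, σ m`. -/
def Trans (m : ℕ) (σ : ℕ → Port V) (s t : Port V) : Prop := ∃ l < m, σ l = s ∧ σ (l + 1) = t

/-- The path system obtained by augmenting `S` along `σ`. -/
def augment (S : V → V → Prop) (m : ℕ) (σ : ℕ → Port V) (u v : V) : Prop :=
  (u ≠ v ∧ Trans m σ (out u) (inn v)) ∨ (S u v ∧ ¬ Trans m σ (inn v) (out u))

/-- The step from `σ l` to `σ (l + 1)` traverses the edge of `G` from `a` to `b`. -/
def EdgeStep (S : V → V → Prop) (σ : ℕ → Port V) (l : ℕ) (a b : V) : Prop :=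
  (a ≠ b ∧ σ l = out a ∧ σ (l + 1) = inn b) ∨ (S b a ∧ σ l = inn a ∧ σ (l + 1) = out b)

/-- `W` is the walk in `G` traced by the final segment `σ k, …, σ m` of `σ`. -/
structure IsTracedBy {G : SimpleGraph V} (S : V → V → Prop) (U : Set V) (m : ℕ)
    (σ : ℕ → Port V) (k : ℕ) {u y : V} (W : G.Walk u y) : Prop where
  darts : ∀ a b, (∃ e ∈ W.darts, e.fst = a ∧ e.snd = b) ↔
    ∃ l, k ≤ l ∧ l < m ∧ EdgeStep S σ l a b
  support : ∀ a ∈ W.support, ∃ l, k ≤ l ∧ l ≤ m ∧ (σ l = inn a ∨ σ l = out a)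
  trail : W.IsTrail
  repeats : ∀ v, List.Duplicate v W.support → v ∈ U
  follows : ∀ (i : ℕ) (hi : i < W.darts.length), (W.darts.get ⟨i, hi⟩).snd ∈ U →
    ¬ S (W.darts.get ⟨i, hi⟩).snd (W.darts.get ⟨i, hi⟩).fst →
    ∃ hi' : i + 1 < W.darts.length,
      S (W.darts.get ⟨i + 1, hi'⟩).snd (W.darts.get ⟨i + 1, hi'⟩).fst
  head : u ∈ U → σ k = inn u → ∃ h0 : 0 < W.darts.length,
    S (W.darts.get ⟨0, h0⟩).snd (W.darts.get ⟨0, h0⟩).fst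

namespace IsTightPath

variable {G : SimpleGraph V} {A B : Set V} {S : V → V → Prop} {U : Set V} {pos : V → ℕ}
  {d : Port V → ℕ} {M : ℕ} {x y : V} {m : ℕ} {σ : ℕ → Port V}

theorem exists_lt_or_eq_and_lt (hS : IsPathSystem G A B S U pos)
    (h : IsTightPath G A B S U d M x y m σ) :
    ∃ κ : Port V → ℕ, ∀ k l, k < l → l ≤ m →
      d (σ k) < d (σ l) ∨ (d (σ k) = d (σ l) ∧ κ (σ l) < κ (σ k)) := by
  classical
  let κ : Port V → ℕ := fun s => match s with
    | inn v => if v ∈ U then 2 * pos v else 1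
    | out v => if v ∈ U then 2 * pos v + 1 else 0
  have hκ : ∀ s t, FreeStep S U s t → κ t < κ s := by
    rintro _ _ (hv | hv | hv)
    · simp [κ, hv]
    · have := hS.pos_lt hv
      simp only [κ, hS.mem_left hv, hS.mem_right hv, if_true]
      omega
    · simp [κ, hv]
  refine ⟨κ, fun k l hkl => ?_⟩
  induction l, hkl using Nat.le_induction with
  | base =>
    intro hl
    rcases h.step k hl with ⟨h1, h2⟩ | ⟨h1, h2⟩
    · exact Or.inr ⟨h2.symm, hκ _ _ h1⟩
    · exact Or.inl (h2 ▸ Nat.lt_succ_self _)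
  | succ l hkl ih =>
    intro hl
    have := ih (by omega)
    rcases h.step l hl with ⟨h1, h2⟩ | ⟨h1, h2⟩
    · have := hκ _ _ h1
      omega
    · omega

theorem injOn (hS : IsPathSystem G A B S U pos) (h : IsTightPath G A B S U d M x y m σ)
    {k l : ℕ} (hk : k ≤ m) (hl : l ≤ m) (hkl : σ k = σ l) : k = l := by
  obtain ⟨κ, hκ⟩ := exists_lt_or_eq_and_lt hS h
  rcases lt_trichotomy k l with hlt | rfl | hlt
  · have := hκ k l hlt hl
    rw [hkl] at this
    omega
  · rfl
  · have := hκ l k hlt hk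
    rw [hkl] at this
    omega

theorem trans_right_unique (hS : IsPathSystem G A B S U pos)
    (h : IsTightPath G A B S U d M x y m σ) {s t r : Port V} (h₁ : Trans m σ s t)
    (h₂ : Trans m σ s r) : t = r := by
  obtain ⟨k, hk, rfl, rfl⟩ := h₁
  obtain ⟨l, hl, hs, rfl⟩ := h₂
  rw [h.injOn hS hk.le hl.le hs.symm]

theorem trans_left_unique (hS : IsPathSystem G A B S U pos)
    (h : IsTightPath G A B S U d M x y m σ) {s t r : Port V} (h₁ : Trans m σ s r)
    (h₂ : Trans m σ t r) : s = t := by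
  obtain ⟨k, hk, rfl, rfl⟩ := h₁
  obtain ⟨l, hl, rfl, hs⟩ := h₂
  have := h.injOn hS (Nat.succ_le_of_lt hk) (Nat.succ_le_of_lt hl) hs.symm
  rw [Nat.succ_injective this]

theorem exists_trans_of_right (h : IsTightPath G A B S U d M x y m σ) {s t : Port V}
    (hst : Trans m σ s t) (ht : t ≠ out y) : ∃ r, Trans m σ t r := by
  obtain ⟨k, hk, rfl, rfl⟩ := hst
  refine ⟨_, k + 1, lt_of_le_of_ne hk ?_, rfl, rfl⟩
  rintro rfl
  exact ht h.last

theorem exists_trans_of_left (h : IsTightPath G A B S U d M x y m σ) {s t : Port V}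
    (hst : Trans m σ s t) (hs : s ≠ inn x) : ∃ r, Trans m σ r s := by
  obtain ⟨k, hk, rfl, rfl⟩ := hst
  cases k with
  | zero => exact absurd h.start hs
  | succ k => exact ⟨_, k, by omega, rfl, rfl⟩

theorem exists_trans_start (h : IsTightPath G A B S U d M x y m σ) :
    ∃ r, Trans m σ (inn x) r := by
  refine ⟨_, 0, Nat.pos_of_ne_zero ?_, h.start, rfl⟩
  rintro rfl
  have := h.start.symm.trans h.last
  simp at this

theorem trans_inn (h : IsTightPath G A B S U d M x y m σ) {v : V} {t : Port V}
    (ht : Trans m σ (inn v) t) : (v ∉ U ∧ t = out v) ∨ ∃ u, S u v ∧ t = out u := by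
  obtain ⟨k, hk, h1, rfl⟩ := ht
  have := h.step k hk
  rw [h1] at this
  generalize σ (k + 1) = t at this
  rcases this with ⟨hv | hv | hv, -⟩ | ⟨hv, -⟩
  · exact Or.inl ⟨hv, rfl⟩
  · exact Or.inr ⟨_, hv, rfl⟩
  · cases hv

theorem trans_out (h : IsTightPath G A B S U d M x y m σ) {v : V} {t : Port V}
    (ht : Trans m σ (out v) t) : (v ∈ U ∧ t = inn v) ∨
      ∃ w, v ≠ w ∧ G.Adj v w ∧ ¬ S v w ∧ ¬ S w v ∧ d (inn w) = d (out v) + 1 ∧ t = inn w := by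
  obtain ⟨k, hk, h1, rfl⟩ := ht
  have := h.step k hk
  rw [h1] at this
  generalize σ (k + 1) = t at this
  rcases this with ⟨hv, -⟩ | ⟨hv, hd⟩
  · cases hv with
    | turn hv => exact Or.inl ⟨hv, rfl⟩
  · cases hv with
    | mk a b c => exact Or.inr ⟨_, a.ne, a, b, c, hd, rfl⟩

theorem exists_of_trans_inn (h : IsTightPath G A B S U d M x y m σ) {v : V} {s : Port V}
    (hs : Trans m σ s (inn v)) : (v ∈ U ∧ s = out v) ∨ ∃ u, u ≠ v ∧ s = out u := by
  cases s with
  | inn u => rcases h.trans_inn hs with ⟨_, h⟩ | ⟨_, _, h⟩ <;> cases h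
  | out u =>
    rcases h.trans_out hs with ⟨h1, h2⟩ | ⟨w, h1, -, -, -, -, h2⟩
    · cases h2
      exact Or.inl ⟨h1, rfl⟩
    · cases h2
      exact Or.inr ⟨u, h1, rfl⟩

theorem exists_of_trans_out (h : IsTightPath G A B S U d M x y m σ) {v : V} {s : Port V}
    (hs : Trans m σ s (out v)) : (v ∉ U ∧ s = inn v) ∨ ∃ w, S v w ∧ s = inn w := by
  cases s with
  | inn u =>
    rcases h.trans_inn hs with ⟨h1, h2⟩ | ⟨w, h1, h2⟩
    · cases h2
      exact Or.inl ⟨h1, rfl⟩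
    · cases h2
      exact Or.inr ⟨u, h1, rfl⟩
  | out u => rcases h.trans_out hs with ⟨_, h⟩ | ⟨_, _, _, _, _, _, h⟩ <;> cases h

theorem new_spec (h : IsTightPath G A B S U d M x y m σ) {u v : V} (huv : u ≠ v)
    (ht : Trans m σ (out u) (inn v)) :
    G.Adj u v ∧ ¬ S u v ∧ ¬ S v u ∧ d (inn v) = d (out u) + 1 := by
  rcases h.trans_out ht with ⟨_, h2⟩ | ⟨w, -, a, b, c, e, h2⟩
  · cases h2
    exact absurd rfl huv
  · cases h2
    exact ⟨a, b, c, e⟩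

theorem augment_right_unique (hS : IsPathSystem G A B S U pos)
    (h : IsTightPath G A B S U d M x y m σ) {u v w : V} (hv : augment S m σ u v)
    (hw : augment S m σ u w) : v = w := by
  have key : ∀ {v w}, u ≠ v → Trans m σ (out u) (inn v) → S u w →
      ¬ Trans m σ (inn w) (out u) → False := by
    intro v w huv ht hs hn
    obtain ⟨r, hr⟩ := h.exists_trans_of_left ht (by simp)
    rcases h.exists_of_trans_out hr with ⟨hU, -⟩ | ⟨w', hw', rfl⟩
    · exact hU (hS.mem_left hs)
    · exact hn (hS.right_unique hs hw' ▸ hr)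
  rcases hv with ⟨h1, h2⟩ | ⟨h1, h2⟩ <;> rcases hw with ⟨h3, h4⟩ | ⟨h3, h4⟩
  · injection h.trans_right_unique hS h2 h4
  · exact (key h1 h2 h3 h4).elim
  · exact (key h3 h4 h1 h2).elim
  · exact hS.right_unique h1 h3

theorem augment_left_unique (hS : IsPathSystem G A B S U pos)
    (h : IsTightPath G A B S U d M x y m σ) {u v w : V} (hu : augment S m σ u w)
    (hv : augment S m σ v w) : u = v := by
  have key : ∀ {u v}, u ≠ w → Trans m σ (out u) (inn w) → S v w →
      ¬ Trans m σ (inn w) (out v) → False := by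
    intro u v huv ht hs hn
    obtain ⟨r, hr⟩ := h.exists_trans_of_right ht (by simp)
    rcases h.trans_inn hr with ⟨hU, -⟩ | ⟨w', hw', rfl⟩
    · exact hU (hS.mem_right hs)
    · exact hn (hS.left_unique hs hw' ▸ hr)
  rcases hu with ⟨h1, h2⟩ | ⟨h1, h2⟩ <;> rcases hv with ⟨h3, h4⟩ | ⟨h3, h4⟩
  · injection h.trans_left_unique hS h2 h4
  · exact (key h1 h2 h3 h4).elim
  · exact (key h3 h4 h1 h2).elim
  · exact hS.left_unique h1 h3

theorem augment_adj (hS : IsPathSystem G A B S U pos)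
    (h : IsTightPath G A B S U d M x y m σ) {u v : V} (huv : augment S m σ u v) :
    G.Adj u v := by
  rcases huv with ⟨h1, h2⟩ | ⟨h1, -⟩
  · exact (h.new_spec h1 h2).1
  · exact hS.adj h1

theorem augment_notMem_A (hS : IsPathSystem G A B S U pos)
    (h : IsTightPath G A B S U d M x y m σ) {u v : V} (huv : augment S m σ u v) : v ∉ A := by
  intro hv
  rcases huv with ⟨h1, h2⟩ | ⟨h1, -⟩
  · by_cases hU : v ∈ U
    · obtain ⟨r, hr⟩ := h.exists_trans_of_right h2 (by simp)
      rcases h.trans_inn hr with ⟨hU', -⟩ | ⟨w, hw, -⟩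
      · exact hU' hU
      · exact hS.notMem_A hw hv
    · have := (h.new_spec h1 h2).2.2.2
      rw [h.d_start v hv hU] at this
      omega
  · exact hS.notMem_A h1 hv

theorem augment_notMem_B (hS : IsPathSystem G A B S U pos)
    (h : IsTightPath G A B S U d M x y m σ) {u v : V} (huv : augment S m σ u v) : u ∉ B := by
  intro hu
  rcases huv with ⟨h1, h2⟩ | ⟨h1, -⟩
  · by_cases hU : u ∈ U
    · obtain ⟨r, hr⟩ := h.exists_trans_of_left h2 (by simp)
      rcases h.exists_of_trans_out hr with ⟨hU', -⟩ | ⟨w, hw, -⟩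
      · exact hU' hU
      · exact hS.notMem_B hw hu
    · have h3 := (h.new_spec h1 h2).2.2.2
      have h4 := h.d_last u hu hU
      have h5 := h.le_bound (inn v)
      omega
  · exact hS.notMem_B h1 hu

theorem exists_augment_of_trans_out (h : IsTightPath G A B S U d M x y m σ) {s : Port V} {v : V}
    (ht : Trans m σ s (out v)) (hv : v ≠ y)
    (hn : Trans m σ (out v) (inn v) → False) : ∃ w, augment S m σ v w := by
  obtain ⟨r, hr⟩ := h.exists_trans_of_right ht (by simpa using hv)
  rcases h.trans_out hr with ⟨-, rfl⟩ | ⟨w, hw, -, -, -, -, rfl⟩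
  · exact (hn hr).elim
  · exact ⟨w, Or.inl ⟨hw, hr⟩⟩

/-- If the successor edge of `v` is cancelled, then `σ` leaves `v` along a new edge, unless it
turns back at `v`. -/
theorem exists_augment_of_mem (hS : IsPathSystem G A B S U pos)
    (h : IsTightPath G A B S U d M x y m σ) {v : V} (hU : v ∈ U) (hB : v ∉ B)
    (hn : Trans m σ (out v) (inn v) → False) : ∃ w, augment S m σ v w := by
  obtain ⟨w, hw⟩ := hS.exists_succ hU hB
  by_cases hK : Trans m σ (inn w) (out v)
  · exact h.exists_augment_of_trans_out hK (fun hvy => h.last_notMem (hvy ▸ hU)) hn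
  · exact ⟨w, Or.inr ⟨hw, hK⟩⟩

theorem exists_augment_right (hS : IsPathSystem G A B S U pos)
    (h : IsTightPath G A B S U d M x y m σ) {u v : V} (huv : augment S m σ u v) (hB : v ∉ B) :
    ∃ w, augment S m σ v w := by
  have hvy : v ≠ y := fun e => hB (e ▸ h.last_mem)
  rcases huv with ⟨h1, h2⟩ | ⟨h1, h2⟩
  · by_cases hU : v ∈ U
    · refine h.exists_augment_of_mem hS hU hB fun ht => h1 ?_
      injection h.trans_left_unique hS h2 ht
    · obtain ⟨r, hr⟩ := h.exists_trans_of_right h2 (by simp)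
      rcases h.trans_inn hr with ⟨-, rfl⟩ | ⟨w, hw, -⟩
      · refine h.exists_augment_of_trans_out hr hvy fun ht => h1 ?_
        injection h.trans_left_unique hS h2 ht
      · exact absurd (hS.mem_right hw) hU
  · refine h.exists_augment_of_mem hS (hS.mem_right h1) hB fun ht => h2 ?_
    obtain ⟨r, hr⟩ := h.exists_trans_of_right ht (by simp)
    rcases h.trans_inn hr with ⟨hU, -⟩ | ⟨w, hw, rfl⟩
    · exact absurd (hS.mem_right h1) hU
    · exact hS.left_unique h1 hw ▸ hr

theorem exists_augment_start (hS : IsPathSystem G A B S U pos)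
    (h : IsTightPath G A B S U d M x y m σ) (hAB : Disjoint A B) :
    ∃ w, augment S m σ x w := by
  obtain ⟨r, hr⟩ := h.exists_trans_start
  rcases h.trans_inn hr with ⟨-, rfl⟩ | ⟨w, hw, -⟩
  · refine h.exists_augment_of_trans_out hr ?_ fun ht => ?_
    · rintro rfl
      exact hAB.notMem_of_mem_left h.start_mem h.last_mem
    · rcases h.trans_out ht with ⟨hU, -⟩ | ⟨w, hw, -, -, -, -, e⟩
      · exact h.start_notMem hU
      · injection e with e
        exact hw e
  · exact absurd (hS.mem_right hw) h.start_notMem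

theorem exists_augment_of_mem_A (hS : IsPathSystem G A B S U pos)
    (h : IsTightPath G A B S U d M x y m σ) (hAB : Disjoint A B) {a : V} (ha : a ∈ A)
    (hU : a ∈ U) : ∃ w, augment S m σ a w := by
  refine h.exists_augment_of_mem hS hU (hAB.notMem_of_mem_left ha) fun ht => ?_
  obtain ⟨r, hr⟩ := h.exists_trans_of_right ht (by simp)
  rcases h.trans_inn hr with ⟨hU', -⟩ | ⟨w, hw, -⟩
  · exact hU' hU
  · exact hS.notMem_A hw ha

theorem exists_augment_left (hS : IsPathSystem G A B S U pos)
    (h : IsTightPath G A B S U d M x y m σ) {v w : V} (hvw : augment S m σ v w) :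
    (∃ u, augment S m σ u v) ∨ v = x ∨ (v ∈ A ∧ v ∈ U) := by
  by_cases hU : v ∈ U
  · by_cases hA : v ∈ A
    · exact Or.inr (Or.inr ⟨hA, hU⟩)
    left
    obtain ⟨u, hu⟩ := hS.exists_pred hU hA
    by_cases hK : Trans m σ (inn v) (out u)
    swap
    · exact ⟨u, Or.inr ⟨hu, hK⟩⟩
    obtain ⟨r, hr⟩ := h.exists_trans_of_left hK
      (by simpa using fun e : v = x => h.start_notMem (e ▸ hU))
    rcases h.exists_of_trans_inn hr with ⟨-, rfl⟩ | ⟨u', hu', rfl⟩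
    · exfalso
      rcases hvw with ⟨h1, h2⟩ | ⟨h1, h2⟩
      · injection h.trans_right_unique hS hr h2 with e
        exact h1 e
      · obtain ⟨s, hs⟩ := h.exists_trans_of_left hr (by simp)
        rcases h.exists_of_trans_out hs with ⟨hU', -⟩ | ⟨w', hw', rfl⟩
        · exact hU' hU
        · exact h2 (hS.right_unique h1 hw' ▸ hs)
    · exact ⟨u', Or.inl ⟨hu', hr⟩⟩
  · rcases hvw with ⟨h1, h2⟩ | ⟨h1, -⟩
    · obtain ⟨s, hs⟩ := h.exists_trans_of_left h2 (by simp)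
      rcases h.exists_of_trans_out hs with ⟨-, rfl⟩ | ⟨w', hw', rfl⟩
      · by_cases hx : v = x
        · exact Or.inr (Or.inl hx)
        obtain ⟨r, hr⟩ := h.exists_trans_of_left hs (by simpa using hx)
        rcases h.exists_of_trans_inn hr with ⟨hU', -⟩ | ⟨u', hu', rfl⟩
        · exact absurd hU' hU
        · exact Or.inl ⟨u', Or.inl ⟨hu', hr⟩⟩
      · exact absurd (hS.mem_left hw') hU
    · exact absurd (hS.mem_left h1) hU

theorem d_inn_le_out_of_trans (hS : IsPathSystem G A B S U pos)
    (h : IsTightPath G A B S U d M x y m σ) {s : Port V} {v : V}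
    (ht : Trans m σ s (inn v)) : d (inn v) ≤ d (out v) := by
  by_cases hU : v ∈ U
  · exact h.free_le (.turn hU)
  · obtain ⟨r, l, hl, h1, rfl⟩ := h.exists_trans_of_right ht (by simp)
    have h2 := h.step l hl
    rcases h.trans_inn ⟨l, hl, h1, rfl⟩ with ⟨-, h3⟩ | ⟨w, hw, -⟩
    · rw [h1, h3] at h2
      rcases h2 with ⟨-, h2⟩ | ⟨h2, -⟩
      · exact h2.ge
      · cases h2
    · exact absurd (hS.mem_right hw) hU

theorem exists_rank (hS : IsPathSystem G A B S U pos)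
    (h : IsTightPath G A B S U d M x y m σ) {K : ℕ} (hK : ∀ v, pos v ≤ K) :
    ∃ (rank : V → ℕ) (N : ℕ), (∀ v, rank v ≤ N) ∧
      ∀ u v, augment S m σ u v → rank u < rank v := by
  refine ⟨fun v => d (out v) * (K + 1) + pos v, M * (K + 1) + K, fun v => ?_, ?_⟩
  · exact add_le_add (Nat.mul_le_mul_right _ (h.le_bound _)) (hK v)
  · rintro u v (⟨h1, h2⟩ | ⟨h1, -⟩)
    · have h3 := (h.new_spec h1 h2).2.2.2
      have h4 := h.d_inn_le_out_of_trans hS h2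
      have h5 := hK u
      have h6 : (d (out u) + 1) * (K + 1) ≤ d (out v) * (K + 1) :=
        Nat.mul_le_mul_right _ (by omega)
      rw [Nat.succ_mul] at h6
      dsimp only
      omega
    · have h3 := h.free_le (.back h1)
      have h4 := h.free_le (.turn (hS.mem_right h1))
      have h5 := hS.pos_lt h1
      have h6 : d (out u) * (K + 1) ≤ d (out v) * (K + 1) :=
        Nat.mul_le_mul_right _ (by omega)
      dsimp only
      omega

/-- The edge set of the augmented system. -/
theorem augment_edges (hS : IsPathSystem G A B S U pos)
    (h : IsTightPath G A B S U d M x y m σ) :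
    {e | ∃ u v, augment S m σ u v ∧ e = s(u, v)} =
      symmDiff {e | ∃ u v, S u v ∧ e = s(u, v)}
        {e | ∃ u v, ((u ≠ v ∧ Trans m σ (out u) (inn v)) ∨
          (S v u ∧ Trans m σ (inn u) (out v))) ∧ e = s(u, v)} := by
  have hasymm : ∀ {u v}, S u v → ¬ S v u := fun h1 h2 =>
    absurd (hS.pos_lt h1) (hS.pos_lt h2).not_gt
  ext e
  rw [Set.mem_symmDiff]
  simp only [Set.mem_ofPred_eq]
  constructor
  · rintro ⟨u, v, ⟨h1, h2⟩ | ⟨h1, h2⟩, rfl⟩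
    · refine Or.inr ⟨⟨u, v, Or.inl ⟨h1, h2⟩, rfl⟩, ?_⟩
      rintro ⟨u', v', h3, h4⟩
      have h5 := h.new_spec h1 h2
      rcases Sym2.eq_iff.1 h4 with ⟨rfl, rfl⟩ | ⟨rfl, rfl⟩
      · exact h5.2.1 h3
      · exact h5.2.2.1 h3
    · refine Or.inl ⟨⟨u, v, h1, rfl⟩, ?_⟩
      rintro ⟨u', v', ⟨h3, h4⟩ | ⟨h3, h4⟩, h5⟩
      · have h6 := h.new_spec h3 h4
        rcases Sym2.eq_iff.1 h5 with ⟨rfl, rfl⟩ | ⟨rfl, rfl⟩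
        · exact h6.2.1 h1
        · exact h6.2.2.1 h1
      · rcases Sym2.eq_iff.1 h5 with ⟨rfl, rfl⟩ | ⟨rfl, rfl⟩
        · exact hasymm h1 h3
        · exact h2 h4
  · rintro (⟨⟨u, v, h1, rfl⟩, h2⟩ | ⟨⟨u, v, ⟨h1, h2⟩ | ⟨h1, h2⟩, rfl⟩, h3⟩)
    · exact ⟨u, v, Or.inr ⟨h1, fun ht => h2 ⟨v, u, Or.inr ⟨h1, ht⟩, Sym2.eq_swap⟩⟩, rfl⟩
    · exact ⟨u, v, Or.inl ⟨h1, h2⟩, rfl⟩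
    · exact absurd ⟨v, u, h1, Sym2.eq_swap⟩ h3

theorem eq_of_edgeStep (hS : IsPathSystem G A B S U pos)
    (h : IsTightPath G A B S U d M x y m σ) {k l : ℕ} {u v a b : V} (hkm : k < m) (hlm : l < m)
    (hk : EdgeStep S σ k u v) (hl : EdgeStep S σ l a b) (he : s(u, v) = s(a, b)) : k = l := by
  rcases hk with ⟨h1, h2, h3⟩ | ⟨h1, h2, h3⟩ <;> rcases hl with ⟨h4, h5, h6⟩ | ⟨h4, h5, h6⟩
  · rcases Sym2.eq_iff.1 he with ⟨rfl, rfl⟩ | ⟨rfl, rfl⟩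
    · exact h.injOn hS hkm.le hlm.le (h2.trans h5.symm)
    · exfalso
      have h7 : Trans m σ (out u) (inn v) := ⟨k, hkm, h2, h3⟩
      have h8 : Trans m σ (out v) (inn u) := ⟨l, hlm, h5, h6⟩
      have h9 := (h.new_spec h1 h7).2.2.2
      have h10 := (h.new_spec h4 h8).2.2.2
      have h11 := h.d_inn_le_out_of_trans hS h7
      have h12 := h.d_inn_le_out_of_trans hS h8
      omega
  · have h7 := h.new_spec h1 ⟨k, hkm, h2, h3⟩
    rcases Sym2.eq_iff.1 he with ⟨rfl, rfl⟩ | ⟨rfl, rfl⟩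
    · exact absurd h4 h7.2.2.1
    · exact absurd h4 h7.2.1
  · have h7 := h.new_spec h4 ⟨l, hlm, h5, h6⟩
    rcases Sym2.eq_iff.1 he with ⟨rfl, rfl⟩ | ⟨rfl, rfl⟩
    · exact absurd h1 h7.2.2.1
    · exact absurd h1 h7.2.1
  · rcases Sym2.eq_iff.1 he with ⟨rfl, rfl⟩ | ⟨rfl, rfl⟩
    · exact h.injOn hS hkm.le hlm.le (h2.trans h5.symm)
    · exact absurd (hS.pos_lt h1) (hS.pos_lt h4).not_gt

theorem mem_of_edgeStep (hS : IsPathSystem G A B S U pos)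
    (h : IsTightPath G A B S U d M x y m σ) {k l : ℕ} {u v : V} (hkl : k < l) (hlm : l ≤ m)
    (hk : EdgeStep S σ k u v) (hl : σ l = inn u ∨ σ l = out u) : u ∈ U := by
  rcases hk with ⟨-, h2, -⟩ | ⟨h1, -, -⟩
  · rcases hl with hl | hl
    · have hlm' : l < m := lt_of_le_of_ne hlm fun e => by
        have := h.last
        rw [← e, hl] at this
        cases this
      rcases h.trans_inn ⟨l, hlm', hl, rfl⟩ with ⟨-, h3⟩ | ⟨w, hw, -⟩
      · have := h.injOn hS hlm' (hkl.le.trans hlm) (h3.trans h2.symm)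
        omega
      · exact hS.mem_right hw
    · have := h.injOn hS hlm (hkl.le.trans hlm) (hl.trans h2.symm)
      omega
  · exact hS.mem_right h1

theorem isTracedBy_cons (hS : IsPathSystem G A B S U pos)
    (h : IsTightPath G A B S U d M x y m σ) {k : ℕ} (hk : k < m) {u v : V} {W : G.Walk v y}
    (hW : IsTracedBy S U m σ (k + 1) W) (huv : G.Adj u v) (he : EdgeStep S σ k u v) :
    IsTracedBy S U m σ k (.cons huv W) where
  darts a b := by
    simp only [SimpleGraph.Walk.darts_cons, List.mem_cons, or_and_right, exists_or, hW.darts,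
      exists_eq_left]
    constructor
    · rintro (⟨rfl, rfl⟩ | ⟨l, h1, h2, h3⟩)
      · exact ⟨k, le_rfl, hk, he⟩
      · exact ⟨l, by omega, h2, h3⟩
    · rintro ⟨l, h1, h2, h3⟩
      rcases h1.eq_or_lt with rfl | h1
      · left
        rcases he with ⟨-, h4, h5⟩ | ⟨-, h4, h5⟩ <;> rcases h3 with ⟨-, h6, h7⟩ | ⟨-, h6, h7⟩ <;>
          simp_all
      · exact Or.inr ⟨l, h1, h2, h3⟩
  support a ha := by
    rw [SimpleGraph.Walk.support_cons, List.mem_cons] at ha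
    rcases ha with rfl | ha
    · refine ⟨k, le_rfl, hk.le, ?_⟩
      rcases he with ⟨-, h4, -⟩ | ⟨-, h4, -⟩
      · exact Or.inr h4
      · exact Or.inl h4
    · obtain ⟨l, h1, h2⟩ := hW.support a ha
      exact ⟨l, by omega, h2⟩
  trail := by
    refine (SimpleGraph.Walk.isTrail_cons _ _).2 ⟨hW.trail, fun hmem => ?_⟩
    obtain ⟨e, he', h1⟩ := List.mem_map.1 hmem
    obtain ⟨l, h2, h3, h4⟩ := (hW.darts _ _).1 ⟨e, he', rfl, rfl⟩
    have := h.eq_of_edgeStep hS hk h3 he h4 h1.symm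
    omega
  repeats a ha := by
    rw [SimpleGraph.Walk.support_cons, List.duplicate_cons_iff] at ha
    rcases ha with ⟨rfl, ha⟩ | ha
    · obtain ⟨l, h1, h2, h3⟩ := hW.support _ ha
      exact h.mem_of_edgeStep hS h1 h2 he h3
    · exact hW.repeats a ha
  follows i hi hU hn := by
    cases i with
    | zero =>
      have hh : σ (k + 1) = inn v := by
        rcases he with ⟨-, -, h4⟩ | ⟨h4, -, -⟩
        · exact h4
        · exact absurd h4 hn
      obtain ⟨h0, h1⟩ := hW.head hU hh
      exact ⟨Nat.succ_lt_succ h0, h1⟩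
    | succ i =>
      obtain ⟨h0, h1⟩ := hW.follows i (Nat.lt_of_succ_lt_succ hi) hU hn
      exact ⟨Nat.succ_lt_succ h0, h1⟩
  head hU hh := by
    refine ⟨Nat.succ_pos _, ?_⟩
    rcases he with ⟨-, h4, -⟩ | ⟨h4, -, -⟩
    · rw [hh] at h4
      cases h4
    · exact h4

theorem exists_isTracedBy (hS : IsPathSystem G A B S U pos)
    (h : IsTightPath G A B S U d M x y m σ) {k : ℕ} (hk : k ≤ m) :
    ∀ u, (σ k = inn u ∨ σ k = out u) → ∃ W : G.Walk u y, IsTracedBy S U m σ k W := by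
  induction hk using Nat.decreasingInduction with
  | self =>
    intro u hu
    rw [h.last] at hu
    rcases hu with hu | hu
    · cases hu
    cases hu
    refine ⟨.nil, ?_, ?_, .nil, ?_, ?_, ?_⟩
    · intro a b
      simp only [SimpleGraph.Walk.darts_nil, List.not_mem_nil, false_and, exists_false,
        false_iff]
      rintro ⟨l, h1, h2, -⟩
      omega
    · intro a ha
      simp only [SimpleGraph.Walk.support_nil, List.mem_singleton] at ha
      exact ⟨m, le_rfl, le_rfl, Or.inr (ha ▸ h.last)⟩
    · intro v hv
      simp at hv
    · intro i hi
      simp at hi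
    · intro hU
      exact absurd hU h.last_notMem
  | of_succ k hk ih =>
    have hshift : ∀ {u} {W : G.Walk u y}, (∀ a b, ¬ EdgeStep S σ k a b) →
        (u ∈ U → σ k ≠ inn u) → IsTracedBy S U m σ (k + 1) W → IsTracedBy S U m σ k W := by
      intro u W hno hin hW
      refine ⟨fun a b => (hW.darts a b).trans ⟨?_, ?_⟩, fun a ha => ?_, hW.trail, hW.repeats,
        hW.follows, fun hU hh => absurd hh (hin hU)⟩
      · rintro ⟨l, h1, h2⟩
        exact ⟨l, by omega, h2⟩
      · rintro ⟨l, h1, h2, h3⟩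
        rcases h1.eq_or_lt with rfl | h1
        · exact absurd h3 (hno a b)
        · exact ⟨l, h1, h2, h3⟩
      · obtain ⟨l, h1, h2⟩ := hW.support a ha
        exact ⟨l, by omega, h2⟩
    intro u hu
    rcases hu with hu | hu
    · rcases h.trans_inn ⟨k, hk, hu, rfl⟩ with ⟨h1, h2⟩ | ⟨w, h1, h2⟩
      · obtain ⟨W, hW⟩ := ih u (Or.inr h2)
        refine ⟨W, hshift ?_ (fun hU => absurd hU h1) hW⟩
        rintro a b (⟨-, h3, -⟩ | ⟨h3, h4, -⟩)
        · rw [hu] at h3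
          cases h3
        · rw [hu] at h4
          cases h4
          exact h1 (hS.mem_right h3)
      · obtain ⟨W, hW⟩ := ih w (Or.inr h2)
        exact ⟨_, h.isTracedBy_cons hS hk hW (hS.adj h1).symm (Or.inr ⟨h1, hu, h2⟩)⟩
    · rcases h.trans_out ⟨k, hk, hu, rfl⟩ with ⟨h1, h2⟩ | ⟨w, hne, hadj, -, -, -, h2⟩
      · obtain ⟨W, hW⟩ := ih u (Or.inl h2)
        refine ⟨W, hshift ?_ (fun _ => by simp [hu]) hW⟩
        rintro a b (⟨h3, h4, h5⟩ | ⟨-, h4, -⟩)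
        · rw [hu] at h4
          rw [h2] at h5
          cases h4
          cases h5
          exact h3 rfl
        · rw [hu] at h4
          cases h4
      · obtain ⟨W, hW⟩ := ih w (Or.inl h2)
        exact ⟨_, h.isTracedBy_cons hS hk hW hadj (Or.inl ⟨hne, hu, h2⟩)⟩

end IsTightPath

end PathSystem

section Family

variable {V : Type*}

theorem exists_maximal_walk {G : SimpleGraph V} {R : V → V → Prop}
    (hadj : ∀ u v, R u v → G.Adj u v) {rank : V → ℕ} {N : ℕ} (hN : ∀ v, rank v ≤ N)
    (hrank : ∀ u v, R u v → rank u < rank v) (u : V) :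
    ∃ (t : V) (W : G.Walk u t), (∀ w, ¬ R t w) ∧ W.IsPath ∧
      (∀ e ∈ W.darts, R e.fst e.snd) ∧ (∀ v ∈ W.support, Relation.ReflTransGen R u v) := by
  induction hn : N - rank u using Nat.strong_induction_on generalizing u with
  | _ n ih =>
    by_cases hw : ∃ w, R u w
    · obtain ⟨w, hw⟩ := hw
      have h1 := hrank _ _ hw
      have h2 := hN w
      obtain ⟨t, W, ht, hp, hd, hs⟩ := ih (N - rank w) (by omega) w rfl
      refine ⟨t, .cons (hadj _ _ hw) W, ht, ?_, ?_, ?_⟩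
      · refine hp.cons fun hu => ?_
        have h3 : ∀ v, Relation.ReflTransGen R w v → rank w ≤ rank v := fun v hv => by
          induction hv with
          | refl => exact le_rfl
          | tail _ h ih => exact ih.trans (hrank _ _ h).le
        have := h3 u (hs u hu)
        omega
      · intro e he
        rw [SimpleGraph.Walk.darts_cons, List.mem_cons] at he
        rcases he with rfl | he
        · exact hw
        · exact hd e he
      · intro v hv
        rw [SimpleGraph.Walk.support_cons, List.mem_cons] at hv
        rcases hv with rfl | hv
        · exact .refl
        · exact .head hw (hs v hv)
    · push Not at hw
      exact ⟨u, .nil, hw, .nil, by simp, fun v hv => by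
        simp only [SimpleGraph.Walk.support_nil, List.mem_singleton] at hv
        exact hv ▸ .refl⟩

theorem exists_dart_of_reflTransGen {G : SimpleGraph V} {R : V → V → Prop}
    (hR : ∀ u v w, R u v → R u w → v = w) {u t : V} (W : G.Walk u t) (ht : ∀ w, ¬ R t w)
    (hd : ∀ e ∈ W.darts, R e.fst e.snd) {a b : V} (ha : Relation.ReflTransGen R u a)
    (hab : R a b) : ∃ e ∈ W.darts, e.fst = a ∧ e.snd = b := by
  induction W with
  | nil =>
    rcases Relation.ReflTransGen.cases_head ha with rfl | ⟨c, hc, -⟩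
    · exact absurd hab (ht _)
    · exact absurd hc (ht _)
  | cons hadj W ih =>
    have h1 := hd _ (List.mem_cons_self)
    rcases Relation.ReflTransGen.cases_head ha with rfl | ⟨c, hc, hca⟩
    · exact ⟨_, List.mem_cons_self, rfl, hR _ _ _ h1 hab⟩
    · cases hR _ _ _ h1 hc
      obtain ⟨e, he, h2⟩ := ih ht (fun e he => hd e (List.mem_cons_of_mem _ he)) hca
      exact ⟨e, List.mem_cons_of_mem _ he, h2⟩

/-- A finite-rank directed graph with in- and outdegrees at most one is a family of disjoint
paths. -/
theorem exists_family {G : SimpleGraph V} {A B : Set V} {R : V → V → Prop}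
    (hadj : ∀ u v, R u v → G.Adj u v) (hright : ∀ u v w, R u v → R u w → v = w)
    (hleft : ∀ u v w, R u w → R v w → u = v) {rank : V → ℕ} {N : ℕ} (hN : ∀ v, rank v ≤ N)
    (hrank : ∀ u v, R u v → rank u < rank v) (hA : ∀ u v, R u v → v ∉ A)
    (hB : ∀ u v, R u v → u ∉ B) {n : ℕ} (s : Fin n → V) (hs : Function.Injective s)
    (hsA : ∀ j, s j ∈ A) (hsucc : ∀ j, ∃ w, R (s j) w)
    (hcont : ∀ u v, R u v → v ∉ B → ∃ w, R v w)
    (hpred : ∀ v w, R v w → (∃ u, R u v) ∨ ∃ j, v = s j) :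
    ∃ P : Fin n → ABPath G A B, PathFamilyDisjoint P ∧
      familyEdges P = {e | ∃ u v, R u v ∧ e = s(u, v)} := by
  choose t W ht hp hd hr using fun j => exists_maximal_walk hadj hN hrank (s j)
  have hhead : ∀ j v, Relation.ReflTransGen R (s j) v → v = s j ∨ ∃ u, R u v := fun j v h => by
    rcases Relation.ReflTransGen.cases_tail h with h | ⟨u, -, h⟩
    · exact Or.inl h
    · exact Or.inr ⟨u, h⟩
  have hmax : ∀ j v, Relation.ReflTransGen R (s j) v → v ∈ B → v = t j := fun j v h hv => by
    have hend := hr j _ (W j).end_mem_support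
    rcases Relation.ReflTransGen.total_of_right_unique (fun a b c => hright a b c) h hend
      with h' | h'
    · rcases Relation.ReflTransGen.cases_head h' with h' | ⟨c, hc, -⟩
      · exact h'
      · exact absurd hv (hB _ _ hc)
    · rcases Relation.ReflTransGen.cases_head h' with h' | ⟨c, hc, -⟩
      · exact h'.symm
      · exact absurd hc (ht j c)
  have htB : ∀ j, t j ∈ B := fun j => by
    by_contra hB'
    rcases hhead j _ (hr j _ (W j).end_mem_support) with h | ⟨u, hu⟩
    · obtain ⟨w, hw⟩ := hsucc j
      exact ht j w (h ▸ hw)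
    · obtain ⟨w, hw⟩ := hcont _ _ hu hB'
      exact ht j w hw
  refine ⟨fun j => ⟨s j, t j, W j, hp j, hsA j, htB j, fun v hv hvA => ?_,
    fun v hv => hmax j v (hr j v hv)⟩, ?_, ?_⟩
  · rcases hhead j v (hr j v hv) with h | ⟨u, hu⟩
    · exact h
    · exact absurd hvA (hA _ _ hu)
  · intro i j hij v hvi hvj
    have hi := Relation.reflTransGen_swap.2 (hr i v hvi)
    have hj := Relation.reflTransGen_swap.2 (hr j v hvj)
    rcases Relation.ReflTransGen.total_of_right_unique
      (fun a b c h1 h2 => hleft b c a h1 h2) hi hj with h | h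
    · rcases Relation.ReflTransGen.cases_head h with h | ⟨c, hc, -⟩
      · exact hij (hs h)
      · exact hA _ _ hc (hsA i)
    · rcases Relation.ReflTransGen.cases_head h with h | ⟨c, hc, -⟩
      · exact hij (hs h).symm
      · exact hA _ _ hc (hsA j)
  · have hroot : ∀ n v, rank v = n → (∃ w, R v w) → ∃ j, Relation.ReflTransGen R (s j) v := by
      intro n
      induction n using Nat.strong_induction_on with
      | _ n ih =>
        rintro v rfl ⟨w, hw⟩
        rcases hpred v w hw with ⟨u, hu⟩ | ⟨j, rfl⟩
        · obtain ⟨j, hj⟩ := ih _ (hrank _ _ hu) u rfl ⟨v, hu⟩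
          exact ⟨j, hj.tail hu⟩
        · exact ⟨j, .refl⟩
    ext e
    simp only [familyEdges, Set.mem_ofPred_eq]
    constructor
    · rintro ⟨j, hj⟩
      obtain ⟨e', he', rfl⟩ := List.mem_map.1 hj
      exact ⟨e'.fst, e'.snd, hd j _ he', rfl⟩
    · rintro ⟨u, v, huv, rfl⟩
      obtain ⟨j, hj⟩ := hroot _ u rfl ⟨v, huv⟩
      obtain ⟨e', he', rfl, rfl⟩ :=
        exists_dart_of_reflTransGen hright (W j) (ht j) (hd j) hj huv
      exact ⟨j, List.mem_map.2 ⟨e', he', rfl⟩⟩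

end Family

section FamilySystem

variable {V : Type*}

theorem idxOf_lt_of_mem_darts [DecidableEq V] {G : SimpleGraph V} {u v : V} {p : G.Walk u v}
    (hp : p.IsPath) {e : G.Dart} (he : e ∈ p.darts) :
    p.support.idxOf e.fst < p.support.idxOf e.snd := by
  induction p with
  | nil => simp at he
  | @cons a b c h p ih =>
    rw [SimpleGraph.Walk.cons_isPath_iff] at hp
    rw [SimpleGraph.Walk.darts_cons, List.mem_cons] at he
    rw [SimpleGraph.Walk.support_cons]
    rcases he with rfl | he
    · rw [List.idxOf_cons_self, List.idxOf_cons_ne _ h.ne]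
      exact Nat.succ_pos _
    · have h1 := p.dart_fst_mem_support_of_mem_darts he
      have h2 := p.dart_snd_mem_support_of_mem_darts he
      have h3 : a ≠ e.fst := fun hh => hp.2 (hh ▸ h1)
      have h4 : a ≠ e.snd := fun hh => hp.2 (hh ▸ h2)
      rw [List.idxOf_cons_ne _ h3, List.idxOf_cons_ne _ h4]
      exact Nat.succ_lt_succ (ih hp.1 he)

theorem eq_of_fst_eq {G : SimpleGraph V} {u v : V} {p : G.Walk u v} (hp : p.IsPath)
    {e f : G.Dart} (he : e ∈ p.darts) (hf : f ∈ p.darts) (h : e.fst = f.fst) : e = f := by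
  refine List.inj_on_of_nodup_map (f := fun e : G.Dart => e.fst) ?_ he hf h
  rw [SimpleGraph.Walk.map_fst_darts]
  exact hp.support_nodup.sublist (List.dropLast_sublist _)

theorem eq_of_snd_eq {G : SimpleGraph V} {u v : V} {p : G.Walk u v} (hp : p.IsPath)
    {e f : G.Dart} (he : e ∈ p.darts) (hf : f ∈ p.darts) (h : e.snd = f.snd) : e = f := by
  refine List.inj_on_of_nodup_map (f := fun e : G.Dart => e.snd) ?_ he hf h
  rw [SimpleGraph.Walk.map_snd_darts]
  exact hp.support_nodup.sublist (List.tail_sublist _)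

theorem exists_dart_of_ne_first {G : SimpleGraph V} {u v w : V} (p : G.Walk u v)
    (hw : w ∈ p.support) (hne : w ≠ u) : ∃ e ∈ p.darts, e.snd = w := by
  rw [← SimpleGraph.Walk.cons_tail_support, List.mem_cons, ← SimpleGraph.Walk.map_snd_darts] at hw
  exact List.mem_map.1 (hw.resolve_left hne)

theorem exists_dart_of_ne_last {G : SimpleGraph V} {u v w : V} (p : G.Walk u v)
    (hw : w ∈ p.support) (hne : w ≠ v) : ∃ e ∈ p.darts, e.fst = w := by
  rw [← SimpleGraph.Walk.map_fst_darts_append, List.mem_append, List.mem_singleton] at hw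
  exact List.mem_map.1 (hw.resolve_right hne)

/-- `u` is immediately followed by `v` on one of the paths of the family `P`. -/
def FamilyNext {G : SimpleGraph V} {A B : Set V} {n : ℕ} (P : Fin n → ABPath G A B)
    (u v : V) : Prop :=
  ∃ j, ∃ e ∈ (P j).walk.darts, e.fst = u ∧ e.snd = v

variable {G : SimpleGraph V} {A B : Set V} {n : ℕ} {P : Fin n → ABPath G A B}

theorem index_unique (hP : PathFamilyDisjoint P) {i j : Fin n} {v : V}
    (hi : v ∈ (P i).walk.support) (hj : v ∈ (P j).walk.support) : i = j := by
  by_contra h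
  exact hP i j h v hi hj

theorem isPathSystem_family (hP : PathFamilyDisjoint P) :
    ∃ (pos : V → ℕ) (K : ℕ), (∀ v, pos v ≤ K) ∧
      IsPathSystem G A B (FamilyNext P) (familySupport P) pos := by
  classical
  let pos : V → ℕ := fun v =>
    if h : ∃ j, v ∈ (P j).walk.support then (P h.choose).walk.support.idxOf v else 0
  have hpos : ∀ j v, v ∈ (P j).walk.support → pos v = (P j).walk.support.idxOf v := by
    intro j v hv
    have h : ∃ j, v ∈ (P j).walk.support := ⟨j, hv⟩
    have h1 := index_unique hP h.choose_spec hv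
    simp only [pos, dif_pos h]
    rw [h1]
  have hfst : ∀ {j} {e : G.Dart}, e ∈ (P j).walk.darts → e.fst ∈ (P j).walk.support :=
    fun he => SimpleGraph.Walk.dart_fst_mem_support_of_mem_darts _ he
  have hsnd : ∀ {j} {e : G.Dart}, e ∈ (P j).walk.darts → e.snd ∈ (P j).walk.support :=
    fun he => SimpleGraph.Walk.dart_snd_mem_support_of_mem_darts _ he
  have hlt : ∀ {j} {e : G.Dart}, e ∈ (P j).walk.darts →
      (P j).walk.support.idxOf e.fst < (P j).walk.support.idxOf e.snd :=
    fun {j} _ he => idxOf_lt_of_mem_darts (P j).isPath he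
  refine ⟨pos, ∑ j, (P j).walk.support.length, fun v => ?_, ?_⟩
  · by_cases h : ∃ j, v ∈ (P j).walk.support
    · obtain ⟨j, hj⟩ := h
      rw [hpos j v hj]
      exact List.idxOf_le_length.trans (Finset.single_le_sum
        (f := fun j => (P j).walk.support.length) (fun _ _ => Nat.zero_le _)
        (Finset.mem_univ j))
    · simp [pos, h]
  · constructor
    · rintro u v ⟨j, e, he, rfl, rfl⟩
      exact e.adj
    · rintro u v w ⟨j, e, he, rfl, rfl⟩ ⟨j', e', he', h1, rfl⟩
      cases index_unique hP (hfst he) (h1 ▸ hfst he')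
      rw [eq_of_fst_eq (P j).isPath he he' h1.symm]
    · rintro u v w ⟨j, e, he, rfl, rfl⟩ ⟨j', e', he', rfl, h1⟩
      cases index_unique hP (hsnd he) (h1 ▸ hsnd he')
      rw [eq_of_snd_eq (P j).isPath he he' h1.symm]
    · rintro u v ⟨j, e, he, rfl, rfl⟩
      rw [hpos j _ (hfst he), hpos j _ (hsnd he)]
      exact hlt he
    · rintro u v ⟨j, e, he, rfl, rfl⟩
      exact ⟨j, hfst he⟩
    · rintro u v ⟨j, e, he, rfl, rfl⟩
      exact ⟨j, hsnd he⟩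
    · rintro u v ⟨j, e, he, rfl, rfl⟩ hA
      have h1 := hlt he
      have h2 : (P j).walk.support.idxOf (P j).first = 0 := by
        rw [← SimpleGraph.Walk.cons_tail_support, List.idxOf_cons_self]
      rw [(P j).meetA _ (hsnd he) hA, h2] at h1
      exact absurd h1 (Nat.not_lt_zero _)
    · rintro u v ⟨j, e, he, rfl, rfl⟩ hB
      have h1 := (P j).isPath.support_nodup
      rw [← SimpleGraph.Walk.map_fst_darts_append, List.nodup_append] at h1
      exact h1.2.2 _ (List.mem_map.2 ⟨e, he, rfl⟩) _ (List.mem_singleton_self _)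
        ((P j).meetB _ (hfst he) hB)
    · rintro v ⟨j, hj⟩ hA
      obtain ⟨e, he, h⟩ := exists_dart_of_ne_first _ hj fun h => hA (h ▸ (P j).firstA)
      exact ⟨e.fst, j, e, he, rfl, h⟩
    · rintro v ⟨j, hj⟩ hB
      obtain ⟨e, he, h⟩ := exists_dart_of_ne_last _ hj fun h => hB (h ▸ (P j).lastB)
      exact ⟨e.snd, j, e, he, h, rfl⟩

theorem familyEdges_eq (P : Fin n → ABPath G A B) :
    familyEdges P = {e | ∃ u v, FamilyNext P u v ∧ e = s(u, v)} := by
  ext e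
  simp only [familyEdges, Set.mem_ofPred_eq]
  constructor
  · rintro ⟨j, hj⟩
    obtain ⟨e', he', rfl⟩ := List.mem_map.1 hj
    exact ⟨e'.fst, e'.snd, ⟨j, e', he', rfl, rfl⟩, rfl⟩
  · rintro ⟨u, v, ⟨j, e', he', rfl, rfl⟩, rfl⟩
    exact ⟨j, List.mem_map.2 ⟨e', he', rfl⟩⟩

theorem reflTransGen_first {j : Fin n} {v : V} (hv : v ∈ (P j).walk.support) :
    Relation.ReflTransGen (FamilyNext P) (P j).first v := by
  have key : ∀ {a b : V} (p : G.Walk a b), (∀ e ∈ p.darts, FamilyNext P e.fst e.snd) →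
      ∀ w ∈ p.support, Relation.ReflTransGen (FamilyNext P) a w := by
    intro a b p
    induction p with
    | nil =>
      intro _ w hw
      simp only [SimpleGraph.Walk.support_nil, List.mem_singleton] at hw
      exact hw ▸ .refl
    | cons h p ih =>
      intro hd w hw
      rw [SimpleGraph.Walk.support_cons, List.mem_cons] at hw
      rcases hw with rfl | hw
      · exact .refl
      · exact .head (hd _ List.mem_cons_self)
          (ih (fun e he => hd e (List.mem_cons_of_mem _ he)) w hw)
  exact key _ (fun e he => ⟨j, e, he, rfl, rfl⟩) v hv

open Port

/-- If the residual digraph does not reach `B` outside the paths, then the last reached vertices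
of the paths form a small separator. -/
theorem exists_separator (hP : PathFamilyDisjoint P)
    (h : ¬ ∃ b ∈ B, b ∉ familySupport P ∧
      ∃ m, Reach G A (FamilyNext P) (familySupport P) m (out b)) :
    ∃ X C : Set V, X.encard ≤ n ∧ A \ X ⊆ C ∧ Disjoint C B ∧
      ∀ v ∈ C, ∀ w, G.Adj v w → w ∉ X → w ∈ C := by
  obtain ⟨pos, -, -, hS⟩ := isPathSystem_family hP
  set S := FamilyNext P
  set U := familySupport P
  let r : Port V → Prop := fun s => ∃ m, Reach G A S U m s
  have hfree : ∀ {s t}, FreeStep S U s t → r s → r t := fun hst ⟨m, hm⟩ => ⟨m, hm.free hst⟩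
  have hback : ∀ {v w}, S v w → r (inn w) → r (inn v) := fun hvw hw =>
    hfree (.turn (hS.mem_left hvw)) (hfree (.back hvw) hw)
  have hprefix : ∀ {v w}, Relation.ReflTransGen S v w → v ≠ w → r (inn w) →
      ∃ z, S v z ∧ r (inn z) := by
    intro v w hvw hne hw
    induction hvw with
    | refl => exact absurd rfl hne
    | @tail a b _ hab ih =>
      by_cases hva : v = a
      · exact ⟨b, hva ▸ hab, hw⟩
      · exact ih hva (hback hab hw)
  let D : Set V := {v | ∃ w, S v w ∧ r (inn w)}
  let X : Set V := {v | v ∈ U ∧ (r (inn v) ∨ v ∈ A) ∧ v ∉ D}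
  let C : Set V := D ∪ {v | v ∉ U ∧ r (inn v)}
  have hout : ∀ v ∈ C, r (out v) := by
    rintro v (⟨w, hw, hr⟩ | ⟨hv, hr⟩)
    · exact hfree (.back hw) hr
    · exact hfree (.pass hv) hr
  have hXeq : ∀ v ∈ X, ∀ w ∈ X, Relation.ReflTransGen S v w → v = w := by
    rintro v ⟨-, -, hv⟩ w ⟨-, hw, -⟩ hvw
    by_contra hne
    rcases hw with hw | hw
    · exact hv (hprefix hvw hne hw)
    · rcases Relation.ReflTransGen.cases_tail hvw with h1 | ⟨c, -, hc⟩
      · exact hne h1.symm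
      · exact hS.notMem_A hc hw
  refine ⟨X, C, ?_, ?_, ?_, ?_⟩
  · have hX : ∀ v : X, ∃ j, v.1 ∈ (P j).walk.support := fun v => v.2.1
    choose f hf using hX
    have hinj : Function.Injective f := by
      intro v w hvw
      have h1 := reflTransGen_first (hf v)
      have h2 := reflTransGen_first (hf w)
      rw [hvw] at h1
      apply Subtype.ext
      have hru : Relator.RightUnique (FamilyNext P) := fun _ _ _ => hS.right_unique
      rcases Relation.ReflTransGen.total_of_right_unique hru h1 h2 with h3 | h3
      · exact hXeq _ v.2 _ w.2 h3
      · exact (hXeq _ w.2 _ v.2 h3).symm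
    have := ENat.card_le_card_of_injective hinj
    rwa [ENat.card_eq_coe_fintype_card (α := Fin n), Fintype.card_fin] at this
  · rintro a ⟨ha, haX⟩
    by_cases hU : a ∈ U
    · left
      by_contra hD
      exact haX ⟨hU, Or.inr ha, hD⟩
    · exact Or.inr ⟨hU, 0, .start ha hU⟩
  · rw [Set.disjoint_left]
    intro b hb hB
    by_cases hU : b ∈ U
    · rcases hb with ⟨w, hw, -⟩ | ⟨hb, -⟩
      · exact hS.notMem_B hw hB
      · exact hb hU
    · exact h ⟨b, hB, hU, hout b hb⟩
  · intro v hv w hvw hw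
    have hin : r (inn w) → w ∈ C := fun hr => by
      by_cases hU : w ∈ U
      · left
        by_contra hD
        exact hw ⟨hU, Or.inl hr, hD⟩
      · exact Or.inr ⟨hU, hr⟩
    by_cases h1 : S v w
    · rcases hv with ⟨z, hz, hr⟩ | ⟨hv, -⟩
      · exact hin (hS.right_unique h1 hz ▸ hr)
      · exact absurd (hS.mem_left h1) hv
    · by_cases h2 : S w v
      · exact Or.inl ⟨v, h2, hfree (.turn (hS.mem_right h2)) (hout v hv)⟩
      · obtain ⟨m, hm⟩ := hout v hv
        exact hin ⟨m + 1, hm.new (.mk hvw h1 h2)⟩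

theorem exists_reach {k : ℕ} (hk : KConnected G k) (hA : (k : ℕ∞) ≤ A.encard)
    (hB : (k : ℕ∞) ≤ B.encard) (hn : n < k) (hP : PathFamilyDisjoint P) :
    ∃ b ∈ B, b ∉ familySupport P ∧
      ∃ m, Reach G A (FamilyNext P) (familySupport P) m (out b) := by
  by_contra h
  obtain ⟨X, C, hX, hAC, hCB, hC⟩ := exists_separator hP h
  have hXk : X.encard < k := hX.trans_lt (by exact_mod_cast hn)
  have hex : ∀ {Y : Set V}, (k : ℕ∞) ≤ Y.encard → ∃ a ∈ Y, a ∉ X := fun {Y} hY => by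
    by_contra! hsub
    exact (hXk.trans_le hY).not_ge (Set.encard_le_encard hsub)
  obtain ⟨a, ha, haX⟩ := hex hA
  obtain ⟨b, hb, hbX⟩ := hex hB
  obtain ⟨p⟩ := (hk X hXk).preconnected ⟨a, haX⟩ ⟨b, hbX⟩
  have key : ∀ {u v : (Xᶜ : Set V)}, (G.induce (Xᶜ : Set V)).Walk u v → u.1 ∈ C → v.1 ∈ C := by
    intro u v p
    induction p with
    | nil => exact id
    | @cons u v w h p ih => exact fun hu => ih (hC _ hu _ h v.2)
  exact Set.disjoint_left.1 hCB (key p (hAC ⟨ha, haX⟩)) hb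

theorem isAlternatingWalk_of_isTracedBy (hP : PathFamilyDisjoint P)
    {d : Port V → ℕ} {M : ℕ} {x y : V} {m : ℕ} {σ : ℕ → Port V}
    (h : IsTightPath G A B (FamilyNext P) (familySupport P) d M x y m σ) {W : G.Walk x y}
    (hW : IsTracedBy (FamilyNext P) (familySupport P) m σ 0 W) : IsAlternatingWalk P W where
  trail := hW.trail
  startA := h.start_mem
  startOff := h.start_notMem
  repeats := hW.repeats
  follows i hi j hj hn := by
    obtain ⟨hi', j', e, he, h1, h2⟩ := hW.follows i hi ⟨j, hj⟩ (by
      rintro ⟨j', e, he, h1, h2⟩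
      cases index_unique hP hj
        (h1 ▸ SimpleGraph.Walk.dart_fst_mem_support_of_mem_darts _ he)
      refine hn (List.mem_map.2 ⟨e, he, ?_⟩)
      exact SimpleGraph.dart_edge_eq_iff _ _ |>.2 (Or.inr (SimpleGraph.Dart.ext _ _
        (Prod.ext h1 h2))))
    refine ⟨hi', ?_⟩
    have h3 : (W.darts.get ⟨i, hi⟩).snd = (W.darts.get ⟨i + 1, hi'⟩).fst :=
      List.isChain_iff_getElem.1 W.isChain_dartAdj_darts i hi'
    cases index_unique hP hj
      (h3 ▸ h2 ▸ SimpleGraph.Walk.dart_snd_mem_support_of_mem_darts _ he)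
    have h4 : (W.darts.get ⟨i + 1, hi'⟩).symm = e :=
      SimpleGraph.Dart.ext _ _ (Prod.ext h1.symm h2.symm)
    exact h4 ▸ he
  backward e he j hj := by
    obtain ⟨l, -, hl, ⟨h1, h2, h3⟩ | ⟨⟨j', e', he', h1, h2⟩, -, -⟩⟩ :=
      (hW.darts _ _).1 ⟨e, he, rfl, rfl⟩
    · exfalso
      have h4 := h.new_spec h1 ⟨l, hl, h2, h3⟩
      obtain ⟨e', he', h5⟩ := List.mem_map.1 hj
      rcases (SimpleGraph.dart_edge_eq_iff _ _).1 h5 with rfl | rfl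
      · exact h4.2.1 ⟨j, _, he', rfl, rfl⟩
      · exact h4.2.2.1 ⟨j, _, he', rfl, rfl⟩
    · cases index_unique hP (SimpleGraph.Walk.fst_mem_support_of_mem_edges _ hj)
        (h2 ▸ SimpleGraph.Walk.dart_snd_mem_support_of_mem_darts _ he')
      have h4 : e.symm = e' := SimpleGraph.Dart.ext _ _ (Prod.ext h1.symm h2.symm)
      exact h4 ▸ he'

theorem IsTracedBy.edges_eq {S : V → V → Prop} {U : Set V} {m : ℕ} {σ : ℕ → Port V} {u y : V}
    {W : G.Walk u y} (hW : IsTracedBy S U m σ 0 W) :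
    {e | e ∈ W.edges} = {e | ∃ u v, ((u ≠ v ∧ Trans m σ (out u) (inn v)) ∨
      (S v u ∧ Trans m σ (inn u) (out v))) ∧ e = s(u, v)} := by
  ext e
  simp only [Set.mem_ofPred_eq]
  constructor
  · intro he
    obtain ⟨e', he', rfl⟩ := List.mem_map.1 he
    obtain ⟨l, -, hl, ⟨h1, h2, h3⟩ | ⟨h1, h2, h3⟩⟩ := (hW.darts _ _).1 ⟨e', he', rfl, rfl⟩
    · exact ⟨e'.fst, e'.snd, Or.inl ⟨h1, l, hl, h2, h3⟩, rfl⟩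
    · exact ⟨e'.fst, e'.snd, Or.inr ⟨h1, l, hl, h2, h3⟩, rfl⟩
  · rintro ⟨u, v, ⟨h1, l, hl, h2, h3⟩ | ⟨h1, l, hl, h2, h3⟩, rfl⟩
    · obtain ⟨e, he, rfl, rfl⟩ := (hW.darts u v).2 ⟨l, Nat.zero_le _, hl, Or.inl ⟨h1, h2, h3⟩⟩
      exact List.mem_map.2 ⟨e, he, rfl⟩
    · obtain ⟨e, he, rfl, rfl⟩ := (hW.darts u v).2 ⟨l, Nat.zero_le _, hl, Or.inr ⟨h1, h2, h3⟩⟩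
      exact List.mem_map.2 ⟨e, he, rfl⟩

theorem exists_augmented_family (hAB : Disjoint A B) (hP : PathFamilyDisjoint P) {pos : V → ℕ}
    {K : ℕ} (hK : ∀ v, pos v ≤ K)
    (hS : IsPathSystem G A B (FamilyNext P) (familySupport P) pos)
    {d : Port V → ℕ} {M : ℕ} {x y : V} {m : ℕ} {σ : ℕ → Port V}
    (h : IsTightPath G A B (FamilyNext P) (familySupport P) d M x y m σ) :
    ∃ P' : Fin (n + 1) → ABPath G A B, PathFamilyDisjoint P' ∧
      familyEdges P' = {e | ∃ u v, augment (FamilyNext P) m σ u v ∧ e = s(u, v)} := by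
  obtain ⟨rank, N, hN, hrank⟩ := h.exists_rank hS hK
  have hfirst : ∀ j, (P j).first ∈ familySupport P := fun j =>
    ⟨j, SimpleGraph.Walk.start_mem_support _⟩
  refine exists_family (fun u v => h.augment_adj hS) (fun u v w => h.augment_right_unique hS)
    (fun u v w => h.augment_left_unique hS) hN hrank (fun u v => h.augment_notMem_A hS)
    (fun u v => h.augment_notMem_B hS) (Fin.cons x fun j => (P j).first) ?_ ?_ ?_
    (fun u v => h.exists_augment_right hS) ?_
  · rw [Fin.cons_injective_iff]
    constructor
    · rintro ⟨j, rfl⟩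
      exact h.start_notMem (hfirst j)
    · intro i j hij
      have hij' : (P i).first = (P j).first := hij
      exact index_unique hP (v := (P i).first) (SimpleGraph.Walk.start_mem_support _)
        (hij'.symm ▸ SimpleGraph.Walk.start_mem_support (P j).walk)
  · exact Fin.cases h.start_mem fun j => (P j).firstA
  · exact Fin.cases (h.exists_augment_start hS hAB) fun j =>
      h.exists_augment_of_mem_A hS hAB (P j).firstA (hfirst j)
  · intro v w hvw
    rcases h.exists_augment_left hS hvw with h1 | rfl | ⟨h1, j, hj⟩
    · exact Or.inl h1
    · exact Or.inr ⟨0, rfl⟩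
    · exact Or.inr ⟨j.succ, (P j).meetA _ hj h1⟩

end FamilySystem

end Augment

/-- In a `k`-connected graph with disjoint vertex sets `A`, `B` of size at
least `k` and a family `P` of `i < k` pairwise disjoint `A`–`B` paths, there is a walk
`W`, alternating with respect to `P` and ending in `B ∖ V(⋃P)`, such that
`E(P) △ E(W)` is precisely the edge set of a family of `i+1` disjoint `A`–`B` paths. -/
theorem statement5 {V : Type*} (G : SimpleGraph V) (k : ℕ) (hk : KConnected G k)
    (A B : Set V) (hAB : Disjoint A B)
    (hA : (k : ℕ∞) ≤ A.encard) (hB : (k : ℕ∞) ≤ B.encard)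
    (i : ℕ) (hik : i < k) (P : Fin i → ABPath G A B) (hP : PathFamilyDisjoint P) :
    ∃ (x y : V) (W : G.Walk x y),
      IsAlternatingWalk P W ∧ y ∈ B ∧ y ∉ familySupport P ∧
      ∃ P' : Fin (i + 1) → ABPath G A B, PathFamilyDisjoint P' ∧
        familyEdges P' = symmDiff (familyEdges P) {e | e ∈ W.edges} := by
  obtain ⟨pos, K, hK, hS⟩ := Augment.isPathSystem_family hP
  obtain ⟨d, M, x, y, m, σ, h⟩ :=
    Augment.exists_isTightPath (Augment.exists_reach hk hA hB hik hP)
  obtain ⟨W, hW⟩ := h.exists_isTracedBy hS (Nat.zero_le m) x (Or.inl h.start)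
  obtain ⟨P', hP', hE⟩ := Augment.exists_augmented_family hAB hP hK hS h
  refine ⟨x, y, W, Augment.isAlternatingWalk_of_isTracedBy hP h hW, h.last_mem,
    h.last_notMem, P', hP', ?_⟩
  rw [hE, h.augment_edges hS, Augment.familyEdges_eq, hW.edges_eq]
end
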